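/- arXiv:1808.03535 — 12 statements merged into one kernel-verified Lean document; each statement's English description precedes it below -/
import Mathlib

section
/- Let H be a real inner product space with induced norm ‖·‖, let U and Û be subspaces of H, let F : H → ℝ be a linear functional, and let I : H → H be a linear map with I(Û) ⊆ U. Assume: (orthogonality) ⟨w, v − I v⟩ = 0 for all w ∈ U and all v ∈ Û; u ∈ U satisfies ⟨u, w⟩ = F(w) for all w ∈ U; û ∈ Û satisfies ⟨û, v⟩ = F(v) for all v ∈ Û; û* ∈ Û satisfies I û* = u; and there exists c ≥ 0 such that |F(v − I v)| ≤ c · ‖v − I v‖ for all v ∈ Û. Then (2/(1+√2)) · ‖û − u‖ ≤ ‖û* − u‖ + c. -/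
open scoped RealInnerProductSpace

/-- Abstract Hilbert-space form of the discrete reliability estimate (1.2):
given the orthogonality of the interpolation `I`, the right-inverse property
`I û* = u`, and the bound on the residual functional `F ∘ (1 - I)` on `Û`,
one has `(2/(1+√2)) ‖û - u‖ ≤ ‖û* - u‖ + c`. -/
theorem abstract_discrete_reliability
    {H : Type*} [NormedAddCommGroup H] [InnerProductSpace ℝ H]
    (U Uhat : Submodule ℝ H) (F : H →ₗ[ℝ] ℝ) (I : H →ₗ[ℝ] H)
    (hI : ∀ v ∈ Uhat, I v ∈ U)
    (horth : ∀ w ∈ U, ∀ v ∈ Uhat, ⟪w, v - I v⟫ = 0)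
    (u : H) (hu : u ∈ U) (hueq : ∀ w ∈ U, ⟪u, w⟫ = F w)
    (uhat : H) (huhat : uhat ∈ Uhat) (huhateq : ∀ v ∈ Uhat, ⟪uhat, v⟫ = F v)
    (ustar : H) (hustar : ustar ∈ Uhat) (hustarI : I ustar = u)
    (c : ℝ) (hc : 0 ≤ c) (hF : ∀ v ∈ Uhat, |F (v - I v)| ≤ c * ‖v - I v‖) :
    (2 / (1 + Real.sqrt 2)) * ‖uhat - u‖ ≤ ‖ustar - u‖ + c := by
  have hv : uhat - ustar ∈ Uhat := Uhat.sub_mem huhat hustar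
  set v := uhat - ustar with hvdef
  have hFv : ⟪uhat - u, v⟫ = F (v - I v) := by
    have h1 := horth u hu v hv
    rw [inner_sub_right] at h1
    rw [inner_sub_left, huhateq v hv, map_sub F v (I v), ← hueq (I v) (hI v hv)]
    linarith
  have hb := (le_abs_self _).trans (hF v hv)
  rw [← hFv] at hb
  have hG : ‖v - I v‖ ^ 2 ≤ ‖v‖ ^ 2 := by
    have h1 := horth (I v) (hI v hv) v hv
    have h2 := norm_add_sq_real (I v) (v - I v)
    rw [add_sub_cancel, h1] at h2
    nlinarith [sq_nonneg ‖I v‖]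
  have hS : ‖ustar - u‖ ^ 2 = ‖uhat - u‖ ^ 2 - 2 * ⟪uhat - u, v⟫ + ‖v‖ ^ 2 := by
    rw [← norm_sub_sq_real, hvdef]
    congr 2
    abel
  have hs0 := norm_nonneg (ustar - u)
  have hE : ‖uhat - u‖ ≤ ‖ustar - u‖ + c := by
    apply abs_le_of_sq_le_sq' _ (by positivity) |>.2
    nlinarith [sq_nonneg (‖v - I v‖ - c), mul_nonneg hs0 hc]
  have h2 : 2 / (1 + Real.sqrt 2) ≤ 1 := by
    have : (1 : ℝ) ≤ Real.sqrt 2 := Real.one_le_sqrt.mpr (by norm_num)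
    rw [div_le_one (by linarith)]
    linarith
  calc _ ≤ 1 * ‖uhat - u‖ := mul_le_mul_of_nonneg_right h2 (norm_nonneg _)
    _ ≤ _ := by rw [one_mul]; exact hE
end

section
/- Let n ∈ ℕ, n ≥ 1, and let x : Fin n → ℝ be monotone, i.e. x₁ ≤ x₂ ≤ … ≤ xₙ. For a simple graph G on the vertex set {1, …, n}, define f(G) := Σ_{{j,k} ∈ E(G)} (x_j − x_k)². Then the minimum of f(G) over all connected simple graphs G on {1, …, n} equals Σ_{j=1}^{n−1} (x_{j+1} − x_j)²; that is, every connected simple graph G on {1,…,n} satisfies Σ_{j=1}^{n−1} (x_{j+1} − x_j)² ≤ Σ_{{j,k} ∈ E(G)} (x_j − x_k)², and the path graph with edges {j, j+1} for j = 1, …, n−1 is connected and attains this value. -/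
open Finset

theorem aux_ico (y : ℕ → ℝ) (hy : Monotone y) (a b : ℕ) (hab : a ≤ b) :
    ∑ j ∈ Finset.Ico a b, (y (j + 1) - y j) ^ 2 ≤ (y b - y a) ^ 2 := by
  induction b, hab using Nat.le_induction with
  | base => simp
  | succ b hab ih =>
    rw [Finset.sum_Ico_succ_top hab]
    have h1 := hy hab
    have h2 := hy (Nat.le_succ b)
    simp only [Nat.succ_eq_add_one] at h2
    nlinarith [mul_nonneg (sub_nonneg.2 h1) (sub_nonneg.2 h2)]

theorem aux_lower (n : ℕ) (x : Fin n → ℝ) (hx : Monotone x)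
    (G : SimpleGraph (Fin n)) (hG : G.Connected) :
    (∑ j : Fin n, if h : (j : ℕ) + 1 < n then (x ⟨(j : ℕ) + 1, h⟩ - x j) ^ 2 else 0) ≤
        ∑ e ∈ G.edgeSet.toFinite.toFinset,
          Sym2.lift ⟨fun a b => (x a - x b) ^ 2, fun a b => by ring⟩ e := by
  classical
  have hn : 0 < n := by
    obtain ⟨v⟩ := hG.nonempty
    exact v.pos
  let y : ℕ → ℝ := fun k => x ⟨min k (n - 1), by omega⟩
  have hy : Monotone y := fun a b hab => hx (by
    rw [Fin.mk_le_mk]; omega)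
  have hyx : ∀ a : Fin n, y a = x a := fun a => by
    have : min (a : ℕ) (n - 1) = a := by omega
    simp only [y, this]
  have hg : ∀ j : Fin n, (if h : (j : ℕ) + 1 < n then (x ⟨(j : ℕ) + 1, h⟩ - x j) ^ 2 else 0)
      = (y (j + 1) - y j) ^ 2 := by
    intro j
    split_ifs with h
    · rw [hyx j, ← hyx ⟨j + 1, h⟩]
    · have : y (j + 1) = y j := by
        have h2 : min ((j : ℕ) + 1) (n - 1) = min (j : ℕ) (n - 1) := by omega
        simp only [y, h2]
      rw [this]; ring
  have key : ∀ e : Sym2 (Fin n),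
      ∑ j : Fin n, (if e.inf ≤ j ∧ j < e.sup then (y (j + 1) - y j) ^ 2 else 0) ≤
        Sym2.lift ⟨fun a b => (x a - x b) ^ 2, fun a b => by ring⟩ e := by
    have key2 : ∀ a b : Fin n, a ≤ b →
        ∑ j : Fin n, (if a ≤ j ∧ j < b then (y (j + 1) - y j) ^ 2 else 0) ≤ (x a - x b) ^ 2 := by
      intro a b hab
      have h := aux_ico y hy a b hab
      rw [hyx, hyx] at h
      have h3 : ∑ j : Fin n, (if a ≤ j ∧ j < b then (y (j + 1) - y j) ^ 2 else 0)
          = ∑ j ∈ Finset.range n,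
            (if (a : ℕ) ≤ j ∧ j < (b : ℕ) then (y (j + 1) - y j) ^ 2 else 0) := by
        rw [Finset.sum_range]
        rfl
      rw [h3, ← Finset.sum_filter]
      have h4 : (Finset.range n).filter (fun j => (a : ℕ) ≤ j ∧ j < (b : ℕ))
          = Finset.Ico (a : ℕ) b := by
        ext j
        simp only [Finset.mem_filter, Finset.mem_range, Finset.mem_Ico]
        omega
      rw [h4]
      nlinarith
    intro e
    induction e using Sym2.ind with
    | _ a b =>
      simp only [Sym2.inf_mk, Sym2.sup_mk, Sym2.lift_mk]
      rcases le_total a b with h | h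
      · simpa [h] using key2 a b h
      · have := key2 b a h
        have h2 : (x a - x b) ^ 2 = (x b - x a) ^ 2 := by ring
        rw [h2]
        simpa [h] using this
  refine le_trans ?_ (Finset.sum_le_sum fun e _ => key e)
  rw [Finset.sum_comm]
  refine Finset.sum_le_sum fun j _ => ?_
  have hnn : ∀ e ∈ G.edgeSet.toFinite.toFinset,
      0 ≤ (if e.inf ≤ j ∧ j < e.sup then (y (j + 1) - y j) ^ 2 else 0) := by
    intro e _
    split_ifs <;> positivity
  by_cases h : (j : ℕ) + 1 < n
  · rw [hg]
    obtain ⟨p⟩ := hG.preconnected j ⟨j + 1, h⟩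
    obtain ⟨d, -, hd1, hd2⟩ := p.exists_boundary_dart {v | v ≤ j} (le_refl j)
      (fun hh => by
        have h5 : (⟨j + 1, h⟩ : Fin n) ≤ j := hh
        rw [Fin.le_def] at h5
        simp at h5)
    have hm : s(d.fst, d.snd) ∈ G.edgeSet.toFinite.toFinset := by
      simp
    refine le_trans ?_ (Finset.single_le_sum hnn hm)
    simp only [Set.mem_ofPred_eq, not_le] at hd1 hd2
    rw [if_pos]
    exact ⟨by simp [hd1], by simp [hd2]⟩
  · rw [dif_neg h]
    exact Finset.sum_nonneg hnn

/-- Appendix B: among all connected simple graphs on `{1, …, n}`, and for a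
monotone vector `x`, the sum `∑_{{j,k} ∈ E} (x j - x k)²` is minimized by the
path graph, with minimal value `∑_{j=1}^{n-1} (x_{j+1} - x_j)²`. -/
theorem minimal_connected_graph_sum (n : ℕ) (hn : 1 ≤ n) (x : Fin n → ℝ)
    (hx : Monotone x) :
    (∀ G : SimpleGraph (Fin n), G.Connected →
      (∑ j : Fin n, if h : (j : ℕ) + 1 < n then (x ⟨(j : ℕ) + 1, h⟩ - x j) ^ 2 else 0) ≤
        ∑ e ∈ G.edgeSet.toFinite.toFinset,
          Sym2.lift ⟨fun a b => (x a - x b) ^ 2, fun a b => by ring⟩ e) ∧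
    (SimpleGraph.pathGraph n).Connected ∧
    (∑ e ∈ (SimpleGraph.pathGraph n).edgeSet.toFinite.toFinset,
        Sym2.lift ⟨fun a b => (x a - x b) ^ 2, fun a b => by ring⟩ e) =
      ∑ j : Fin n, if h : (j : ℕ) + 1 < n then (x ⟨(j : ℕ) + 1, h⟩ - x j) ^ 2 else 0 := by
  have hc : (SimpleGraph.pathGraph n).Connected := by
    obtain ⟨m, rfl⟩ := Nat.exists_eq_add_of_le' hn
    exact SimpleGraph.pathGraph_connected m
  refine ⟨fun G hG => aux_lower n x hx G hG, hc, ?_⟩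
  classical
  let φ : Fin n → Sym2 (Fin n) := fun j => if h : (j : ℕ) + 1 < n then s(j, ⟨j + 1, h⟩) else s(j, j)
  have hE : (SimpleGraph.pathGraph n).edgeSet.toFinite.toFinset
      = (Finset.univ.filter fun j : Fin n => (j : ℕ) + 1 < n).image φ := by
    ext e
    induction e using Sym2.ind with
    | _ a b =>
      simp only [Set.Finite.mem_toFinset, SimpleGraph.mem_edgeSet, SimpleGraph.pathGraph_adj,
        Finset.mem_image, Finset.mem_filter, Finset.mem_univ, true_and]
      constructor
      · rintro (h | h)
        · refine ⟨a, by omega, ?_⟩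
          have h1 : (a : ℕ) + 1 < n := by omega
          have h2 : (⟨a + 1, h1⟩ : Fin n) = b := Fin.ext h
          simp only [φ, dif_pos h1, h2]
        · refine ⟨b, by omega, ?_⟩
          have h1 : (b : ℕ) + 1 < n := by omega
          have h2 : (⟨b + 1, h1⟩ : Fin n) = a := Fin.ext h
          simp only [φ, dif_pos h1, h2]
          exact Sym2.eq_swap
      · rintro ⟨j, h1, h⟩
        simp only [φ, dif_pos h1, Sym2.eq_iff, Fin.ext_iff] at h
        omega
  rw [hE, Finset.sum_image, Finset.sum_filter]
  · refine Finset.sum_congr rfl fun j _ => ?_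
    by_cases h : (j : ℕ) + 1 < n
    · simp only [φ, dif_pos h, if_pos h, Sym2.lift_mk]
      ring
    · simp only [dif_neg h, if_neg h]
  · intro i hi j hj hij
    simp only [Finset.coe_filter, Finset.mem_univ, true_and, Set.mem_ofPred_eq] at hi hj
    simp only [φ, dif_pos hi, dif_pos hj, Sym2.eq_iff, Fin.ext_iff] at hij
    ext
    omega
end

section
/- Let j ∈ ℕ, j ≥ 1, let x : Fin j → ℝ satisfy Σ_{k=1}^{j} x_k = 0, and let G be a connected simple graph on the vertex set {1, …, j}. Then max_{k=1,…,j} x_k² ≤ ((j−1)(2j−1)/(6j)) · Σ_{{α,β} ∈ E(G)} (x_α − x_β)². -/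
open Finset

lemma aux_top (y : ℕ → ℝ) (n : ℕ) :
    ∑ v ∈ range (n+1), y v = (n+1) * y n - ∑ i ∈ range n, ((i:ℝ)+1) * (y (i+1) - y i) := by
  induction n with
  | zero => simp
  | succ n ih => rw [sum_range_succ, ih, sum_range_succ _ n]; push_cast; ring

lemma aux_bot (y : ℕ → ℝ) (n : ℕ) :
    ∑ v ∈ range (n+1), y v = (n+1) * y 0 + ∑ i ∈ range n, ((n:ℝ)-i) * (y (i+1) - y i) := by
  induction n with
  | zero => simp
  | succ n ih =>
    rw [sum_range_succ, ih, sum_range_succ _ n]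
    have h := sum_range_sub y n
    have h2 : ∑ i ∈ range n, (((n+1:ℕ):ℝ)-i) * (y (i+1) - y i)
        = ∑ i ∈ range n, ((n:ℝ)-i) * (y (i+1) - y i) + ∑ i ∈ range n, (y (i+1) - y i) := by
      rw [← sum_add_distrib]
      refine sum_congr rfl fun i _ => ?_
      push_cast; ring
    rw [h2, h]; push_cast; ring

lemma aux_sq1 (n : ℕ) : ∑ i ∈ range n, ((i:ℝ)+1)^2 = (n:ℝ)*(n+1)*(2*n+1)/6 := by
  induction n with
  | zero => simp
  | succ n ih => rw [sum_range_succ, ih]; push_cast; ring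

lemma aux_sq2 (n : ℕ) : ∑ i ∈ range n, ((n:ℝ)-i)^2 = (n:ℝ)*(n+1)*(2*n+1)/6 := by
  induction n with
  | zero => simp
  | succ n ih =>
    rw [sum_range_succ']
    have : ∑ i ∈ range n, (((n+1:ℕ):ℝ)-((i+1:ℕ):ℝ))^2 = ∑ i ∈ range n, ((n:ℝ)-i)^2 :=
      sum_congr rfl fun i _ => by push_cast; ring
    rw [this, ih]; push_cast; ring

lemma aux_end (n : ℕ) (z S : ℝ) (w d : ℕ → ℝ) (hw : ∑ i ∈ range n, w i^2 = (n:ℝ)*(n+1)*(2*n+1)/6)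
    (hz : ((n+1)*z)^2 = (∑ i ∈ range n, w i * d i)^2) (hS : ∑ i ∈ range n, d i^2 ≤ S) :
    z^2 ≤ (n:ℝ)*(2*n+1)/(6*(n+1)) * S := by
  have h := sum_mul_sq_le_sq_mul_sq (range n) w d
  rw [← hz, hw] at h
  have hn : (0:ℝ) ≤ n := n.cast_nonneg
  have h3 : ((n+1)*z)^2 ≤ (n:ℝ)*(n+1)*(2*n+1)/6 * S :=
    h.trans (mul_le_mul_of_nonneg_left hS (by positivity))
  have h4 : (n:ℝ)*(n+1)*(2*n+1)/6 * S = (n+1)^2 * ((n:ℝ)*(2*n+1)/(6*(n+1)) * S) := by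
    field_simp
  rw [h4, mul_pow] at h3
  exact le_of_mul_le_mul_left h3 (by positivity)

lemma aux_cross {V : Type*} (G : SimpleGraph V) (hG : G.Connected) (S : Set V) (u v : V)
    (hu : u ∈ S) (hv : v ∉ S) : ∃ a b, G.Adj a b ∧ a ∈ S ∧ b ∉ S := by
  obtain ⟨p⟩ := hG.preconnected u v
  obtain ⟨d, -, h1, h2⟩ := p.exists_boundary_dart S hu hv
  exact ⟨d.fst, d.snd, d.adj, h1, h2⟩

/-- Combination of the Appendix B and Appendix C lemmas: for `x : Fin j → ℝ` with
vanishing sum and a connected simple graph `G` on `{1, …, j}`,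
`max_k x_k² ≤ ((j-1)(2j-1)/(6j)) ∑_{{α,β} ∈ E(G)} (x_α - x_β)²`. -/
theorem max_sq_le_connected_graph_sum (j : ℕ) (hj : 1 ≤ j) (x : Fin j → ℝ)
    (hx : ∑ k, x k = 0) (G : SimpleGraph (Fin j)) (hG : G.Connected) :
    Finset.univ.sup' (Finset.univ_nonempty_iff.mpr ⟨⟨0, hj⟩⟩) (fun k => x k ^ 2) ≤
      (((j : ℝ) - 1) * (2 * (j : ℝ) - 1) / (6 * (j : ℝ))) *
        ∑ e ∈ G.edgeSet.toFinite.toFinset,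
          Sym2.lift ⟨fun a b => (x a - x b) ^ 2, fun a b => by ring⟩ e := by
  classical
  obtain ⟨n, rfl⟩ : ∃ n, j = n + 1 := ⟨j - 1, by omega⟩
  set f : Sym2 (Fin (n+1)) → ℝ :=
    Sym2.lift ⟨fun a b => (x a - x b) ^ 2, fun a b => by ring⟩ with hf
  have hfab : ∀ a b, f s(a,b) = (x a - x b)^2 := fun a b => rfl
  set σ := Tuple.sort x with hσ
  have hmono : Monotone (x ∘ σ) := Tuple.monotone_sort x
  let y : ℕ → ℝ := fun i => x (σ ⟨min i n, by omega⟩)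
  have hy : Monotone y := fun a b hab => hmono (by
    rw [Fin.mk_le_mk]; omega)
  have hyx : ∀ k, y (σ.symm k).val = x k := fun k => by
    have h : (⟨min (σ.symm k).val n, by omega⟩ : Fin (n+1)) = σ.symm k := by
      ext; simp; omega
    simp only [y]
    rw [h]; simp
  have hsum : ∑ v ∈ range (n+1), y v = 0 := by
    rw [Finset.sum_range, ← hx, ← Equiv.sum_comp σ x]
    refine sum_congr rfl fun i _ => ?_
    rw [← hyx (σ i)]; simp
  have hcross : ∀ i, ∃ a b, i < n → G.Adj a b ∧ (σ.symm a).val ≤ i ∧ i < (σ.symm b).val := by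
    intro i
    by_cases hi : i < n
    · obtain ⟨a, b, h1, h2, h3⟩ := aux_cross G hG {a | (σ.symm a).val ≤ i} (σ 0) (σ (Fin.last n))
        (by simp) (by simpa using hi)
      exact ⟨a, b, fun _ => ⟨h1, h2, not_le.mp h3⟩⟩
    · exact ⟨0, 0, fun h => absurd h hi⟩
  choose A B hAB using hcross
  have hS : ∑ i ∈ range n, (y (i+1) - y i)^2 ≤ ∑ e ∈ G.edgeSet.toFinite.toFinset, f e := by
    rw [← sum_fiberwise_of_maps_to (s := range n) (t := G.edgeSet.toFinite.toFinset)
      (g := fun i => s(A i, B i)) (fun i hi => by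
        simpa using (hAB i (mem_range.mp hi)).1)]
    refine sum_le_sum fun e _ => ?_
    have key : ∀ a b, (σ.symm a).val ≤ (σ.symm b).val →
        ∑ i ∈ range n with s(A i, B i) = s(a,b), (y (i+1) - y i)^2 ≤ f s(a,b) := by
      intro a b hab
      calc _ ≤ ∑ i ∈ Ico (σ.symm a).val (σ.symm b).val, (y (i+1) - y i)^2 := by
            refine sum_le_sum_of_subset_of_nonneg ?_ fun _ _ _ => sq_nonneg _
            intro i hi
            rw [mem_filter, mem_range] at hi
            obtain ⟨hi, he⟩ := hi
            obtain ⟨-, h1, h2⟩ := hAB i hi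
            rw [mem_Ico]
            rcases Sym2.eq_iff.mp he with ⟨h3, h4⟩ | ⟨h3, h4⟩
            · rw [h3] at h1; rw [h4] at h2; exact ⟨h1, h2⟩
            · rw [h3] at h1; rw [h4] at h2; omega
        _ ≤ (∑ i ∈ Ico (σ.symm a).val (σ.symm b).val, (y (i+1) - y i))^2 :=
            sum_sq_le_sq_sum_of_nonneg fun i _ => sub_nonneg.mpr (hy (Nat.le_succ i))
        _ = f s(a,b) := by
            rw [sum_Ico_sub y hab, hyx, hyx, hfab]; ring
    induction e using Sym2.ind with
    | _ a b =>
      rcases le_total (σ.symm a).val (σ.symm b).val with h | h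
      · exact key a b h
      · rw [Sym2.eq_swap]; exact key b a h
  have hC : (((n + 1 : ℕ) : ℝ) - 1) * (2 * ((n + 1 : ℕ) : ℝ) - 1) / (6 * ((n + 1 : ℕ) : ℝ))
      = (n:ℝ)*(2*n+1)/(6*(n+1)) := by
    push_cast; ring
  rw [hC]
  have htop := aux_end n (y n) _ (fun i => (i:ℝ)+1) (fun i => y (i+1) - y i) (aux_sq1 n)
    (by have := aux_top y n
        rw [hsum] at this
        congr 1; linarith) hS
  have hbot := aux_end n (y 0) _ (fun i => (n:ℝ)-i) (fun i => y (i+1) - y i) (aux_sq2 n)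
    (by have := aux_bot y n
        rw [hsum] at this
        rw [← neg_sq]
        congr 1; linarith) hS
  refine sup'_le _ _ fun k _ => ?_
  have h1 : x k ≤ y n := by rw [← hyx k]; exact hy (by omega)
  have h2 : y 0 ≤ x k := by rw [← hyx k]; exact hy (by omega)
  rcases le_total 0 (x k) with h | h
  · exact le_trans (by nlinarith) htop
  · exact le_trans (by nlinarith) hbot
end

section
/- Let n ∈ ℕ, n ≥ 1, and let x = (x₁, …, xₙ) ∈ ℝⁿ satisfy Σ_{j=1}^{n} x_j = 0. Then max_{j=1,…,n} x_j² ≤ ((n−1)(2n−1)/(6n)) · Σ_{j=1}^{n−1} (x_{j+1} − x_j)². -/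
open Finset

lemma aux_left (y : ℕ → ℝ) (k : ℕ) :
    ∑ i ∈ range k, ((i : ℝ) + 1) * (y (i + 1) - y i) = k * y k - ∑ i ∈ range k, y i := by
  induction k with
  | zero => simp
  | succ k ih => rw [sum_range_succ, ih, sum_range_succ]; push_cast; ring

lemma aux_right (m : ℕ) : ∀ y : ℕ → ℝ,
    ∑ i ∈ range m, ((m : ℝ) - i) * (y (i + 1) - y i) = ∑ i ∈ range m, y (i + 1) - m * y 0 := by
  induction m with
  | zero => intro y; simp
  | succ m ih =>
    intro y
    have h := ih (fun i => y (i + 1))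
    rw [sum_range_succ', sum_range_succ' (fun i => y (i + 1))]
    have e : ∑ i ∈ range m, (((m + 1 : ℕ) : ℝ) - ((i + 1 : ℕ) : ℝ)) * (y (i + 1 + 1) - y (i + 1))
        = ∑ i ∈ range m, ((m : ℝ) - i) * (y (i + 1 + 1) - y (i + 1)) := by
      refine sum_congr rfl fun i _ => ?_
      push_cast; ring
    rw [e, h]; push_cast; ring

lemma aux_sq_left (k : ℕ) :
    ∑ i ∈ range k, ((i : ℝ) + 1) ^ 2 = (k : ℝ) * (k + 1) * (2 * k + 1) / 6 := by
  induction k with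
  | zero => simp
  | succ k ih => rw [sum_range_succ, ih]; push_cast; ring

lemma aux_sq_right (m : ℕ) :
    ∑ i ∈ range m, ((m : ℝ) - i) ^ 2 = (m : ℝ) * (m + 1) * (2 * m + 1) / 6 := by
  induction m with
  | zero => simp
  | succ m ih =>
    rw [sum_range_succ']
    have e : ∑ i ∈ range m, (((m + 1 : ℕ) : ℝ) - ((i + 1 : ℕ) : ℝ)) ^ 2
        = ∑ i ∈ range m, ((m : ℝ) - i) ^ 2 := by
      refine sum_congr rfl fun i _ => ?_
      push_cast; ring
    rw [e, ih]; push_cast; ring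

lemma aux_main (y : ℕ → ℝ) (k m : ℕ) (hy : ∑ i ∈ range (k + m + 1), y i = 0) :
    (((k : ℝ) + m + 1) * y k) ^ 2 ≤ (((k : ℝ) + m) * (k + m + 1) * (2 * (k + m) + 1) / 6) *
      ∑ i ∈ range (k + m), (y (i + 1) - y i) ^ 2 := by
  let c : ℕ → ℝ := fun i => if i < k then (i : ℝ) + 1 else -((m : ℝ) - ((i : ℝ) - k))
  have c1 : ∀ i ∈ range k, c i = (i : ℝ) + 1 := fun i hi => by
    simp [c, mem_range.mp hi]
  have c2 : ∀ i, c (k + i) = -((m : ℝ) - i) := fun i => by simp [c]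
  have h1 : ∑ i ∈ range (k + m), c i * (y (i + 1) - y i) = ((k : ℝ) + m + 1) * y k := by
    rw [sum_range_add, sum_congr rfl (fun i hi => by rw [c1 i hi]), aux_left]
    have h := aux_right m (fun i => y (k + i))
    simp only [c2, neg_mul, sum_neg_distrib]
    simp only [← add_assoc, add_zero] at h
    rw [h]
    rw [add_assoc, sum_range_add, sum_range_succ'] at hy
    simp only [← add_assoc, add_zero] at hy
    linarith
  have h2 : ∑ i ∈ range (k + m), c i ^ 2 ≤ ((k : ℝ) + m) * (k + m + 1) * (2 * (k + m) + 1) / 6 := by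
    rw [sum_range_add, sum_congr rfl (fun i hi => by rw [c1 i hi]), aux_sq_left]
    simp only [c2, neg_sq]
    rw [aux_sq_right]
    have hk : (0 : ℝ) ≤ k := Nat.cast_nonneg k
    have hm : (0 : ℝ) ≤ m := Nat.cast_nonneg m
    have a : (0 : ℝ) ≤ k * m * (k + m + 1) := by positivity
    nlinarith
  rw [← h1]
  exact (sum_mul_sq_le_sq_mul_sq _ _ _).trans
    (mul_le_mul_of_nonneg_right h2 (sum_nonneg fun i _ => sq_nonneg _))

/-- Appendix C lemma: for `x ∈ ℝⁿ` with vanishing sum,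
`max_j x_j² ≤ ((n-1)(2n-1)/(6n)) ∑_{j=1}^{n-1} (x_{j+1} - x_j)²`. -/
theorem max_sq_le_consecutive_differences (n : ℕ) (hn : 1 ≤ n) (x : Fin n → ℝ)
    (hx : ∑ j, x j = 0) :
    Finset.univ.sup' (Finset.univ_nonempty_iff.mpr ⟨⟨0, hn⟩⟩) (fun j => x j ^ 2) ≤
      (((n : ℝ) - 1) * (2 * (n : ℝ) - 1) / (6 * (n : ℝ))) *
        ∑ j : Fin n, if h : (j : ℕ) + 1 < n then (x ⟨(j : ℕ) + 1, h⟩ - x j) ^ 2 else 0 := by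
  apply Finset.sup'_le
  intro j _
  obtain ⟨k, hk⟩ := j
  obtain ⟨m, rfl⟩ : ∃ m, n = k + m + 1 := ⟨n - k - 1, by omega⟩
  let y : ℕ → ℝ := fun i => if h : i < k + m + 1 then x ⟨i, h⟩ else 0
  have hy : ∀ i : Fin (k + m + 1), y i = x i := fun i => dif_pos i.isLt
  have hs : ∑ i ∈ range (k + m + 1), y i = 0 := by
    rw [← Fin.sum_univ_eq_sum_range, ← hx]
    exact sum_congr rfl fun i _ => hy i
  have hD : (∑ j : Fin (k + m + 1), if h : (j : ℕ) + 1 < k + m + 1 then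
      (x ⟨(j : ℕ) + 1, h⟩ - x j) ^ 2 else 0) = ∑ i ∈ range (k + m), (y (i + 1) - y i) ^ 2 := by
    rw [← Fin.sum_univ_eq_sum_range (fun i => (y (i + 1) - y i) ^ 2), Fin.sum_univ_castSucc]
    simp only [Fin.val_last, lt_irrefl, dite_false, add_zero]
    refine sum_congr rfl fun i _ => ?_
    have hi : (i : ℕ) + 1 < k + m + 1 := by omega
    have e1 := hy ⟨i + 1, hi⟩
    have e2 := hy i.castSucc
    simp only [Fin.val_castSucc] at e1 e2 ⊢
    rw [dif_pos hi, ← e1, ← e2]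
  have main := aux_main y k m hs
  have hyk : y k = x ⟨k, hk⟩ := hy ⟨k, hk⟩
  rw [hD, ← hyk]
  generalize ∑ i ∈ range (k + m), (y (i + 1) - y i) ^ 2 = D at main
  push_cast
  have hN : (0 : ℝ) < (k : ℝ) + m + 1 := by positivity
  rw [div_mul_eq_mul_div, le_div_iff₀ (by positivity)]
  refine le_of_mul_le_mul_left ?_ hN
  nlinarith
end

section
/- Let n ∈ ℕ, n ≥ 2. For every constant C < (n−1)(2n−1)/(6n) there exists x = (x₁, …, xₙ) ∈ ℝⁿ with Σ_{j=1}^{n} x_j = 0 such that C · Σ_{j=1}^{n−1} (x_{j+1} − x_j)² < max_{j=1,…,n} x_j². -/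
open Finset

/-- The mean of `j (j + 1) / 2` over `j = 0, …, m`. -/
noncomputable def c0 (m : ℕ) : ℝ := (m : ℝ) * (m + 2) / 6

/-- Optimality in the Appendix C lemma: for every `C < (n-1)(2n-1)/(6n)` there is
`x ∈ ℝⁿ` with vanishing sum such that
`C ∑_{j=1}^{n-1} (x_{j+1} - x_j)² < max_j x_j²`. -/
theorem consecutive_differences_constant_optimal (n : ℕ) (hn : 2 ≤ n) (C : ℝ)
    (hC : C < ((n : ℝ) - 1) * (2 * (n : ℝ) - 1) / (6 * (n : ℝ))) :
    ∃ x : Fin n → ℝ, (∑ j, x j = 0) ∧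
      C * (∑ j : Fin n, if h : (j : ℕ) + 1 < n then (x ⟨(j : ℕ) + 1, h⟩ - x j) ^ 2 else 0) <
        Finset.univ.sup' (Finset.univ_nonempty_iff.mpr ⟨⟨0, by omega⟩⟩) (fun j => x j ^ 2) := by
  obtain ⟨m, rfl⟩ : ∃ m, n = m + 1 := ⟨n - 1, by omega⟩
  have hm : (1 : ℝ) ≤ m := by exact_mod_cast (by omega : 1 ≤ m)
  have h1 : ∀ k : ℕ, ∑ j ∈ Finset.range k, ((j : ℝ) * (j + 1) / 2 - c0 m)
      = ((k : ℝ) - 1) * k * (k + 1) / 6 - k * c0 m := by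
    intro k
    induction k with
    | zero => simp
    | succ k ih => rw [Finset.sum_range_succ, ih]; push_cast; ring
  have h2 : ∀ k : ℕ, ∑ j ∈ Finset.range k, ((j : ℝ) + 1) ^ 2
      = (k : ℝ) * (k + 1) * (2 * k + 1) / 6 := by
    intro k
    induction k with
    | zero => simp
    | succ k ih => rw [Finset.sum_range_succ, ih]; push_cast; ring
  refine ⟨fun j => ((j : ℕ) : ℝ) * ((j : ℕ) + 1) / 2 - c0 m, ?_, ?_⟩
  · rw [Fin.sum_univ_eq_sum_range (fun j : ℕ => (j : ℝ) * (j + 1) / 2 - c0 m), h1]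
    unfold c0
    push_cast
    ring
  · have h3 : (∑ j : Fin (m + 1), if h : (j : ℕ) + 1 < m + 1 then
        ((((⟨(j : ℕ) + 1, h⟩ : Fin (m + 1)) : ℕ) : ℝ) *
          ((((⟨(j : ℕ) + 1, h⟩ : Fin (m + 1)) : ℕ) : ℝ) + 1) / 2 - c0 m
          - (((j : ℕ) : ℝ) * ((j : ℕ) + 1) / 2 - c0 m)) ^ 2 else 0)
        = (m : ℝ) * (m + 1) * (2 * m + 1) / 6 := by
      rw [← h2 m, Fin.sum_univ_castSucc, ← Fin.sum_univ_eq_sum_range (fun j : ℕ => ((j : ℝ) + 1) ^ 2)]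
      simp only [Fin.val_last, lt_irrefl, dite_false, add_zero]
      refine Finset.sum_congr rfl fun j _ => ?_
      have hj : ((j.castSucc : Fin (m + 1)) : ℕ) + 1 < m + 1 := by simp
      rw [dif_pos hj]
      simp only [Fin.val_castSucc]
      push_cast
      ring
    rw [h3]
    refine lt_of_lt_of_le ?_ (Finset.le_sup' (fun j : Fin (m + 1) =>
      (((j : ℕ) : ℝ) * ((j : ℕ) + 1) / 2 - c0 m) ^ 2) (Finset.mem_univ (Fin.last m)))
    have hS : (0 : ℝ) < (m : ℝ) * (m + 1) * (2 * m + 1) / 6 := by positivity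
    refine lt_of_lt_of_eq (mul_lt_mul_of_pos_right hC hS) ?_
    simp only [Fin.val_last]
    unfold c0
    push_cast
    field_simp
    ring
end

section
/- Let a < b be real numbers, k ∈ ℕ, and let f be a real polynomial of degree at most k. Then |f(a)| ≤ ((k+1)/√(b−a)) · (∫_a^b f(t)² dt)^{1/2}. -/
open Polynomial in
lemma kernel_coeffs (k : ℕ) : ∃ c : ℕ → ℝ, c 0 = ((k : ℝ) + 1) ^ 2 ∧
    ∀ i ∈ Finset.range (k + 1), ∑ j ∈ Finset.range (k + 1), c j / ((i : ℝ) + j + 1) =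
      if i = 0 then 1 else 0 := by
  let v : ℕ → ℝ := fun j => -((j : ℝ) + 1)
  let s := Finset.range (k + 1)
  let P : ℝ[X] := C ((k : ℝ) + 1) * ∏ i ∈ Finset.range k, (C ((i : ℝ) + 1) - X)
  have hv : Set.InjOn v s := by
    intro x _ y _ h
    simpa [v] using h
  have hev : ∀ x, P.eval x = ((k : ℝ) + 1) * ∏ i ∈ Finset.range k, (((i : ℝ) + 1) - x) := by
    intro x
    simp [P, eval_prod]
  have hdeg : P.degree < s.card := by
    have h1 : P.natDegree ≤ k := by
      refine (natDegree_C_mul_le _ _).trans ?_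
      refine (natDegree_prod_le _ _).trans ?_
      refine (Finset.sum_le_sum (g := fun _ => 1) ?_).trans (by simp)
      intro i _
      exact (natDegree_sub_le _ _).trans (by rw [natDegree_C, natDegree_X]; simp)
    refine lt_of_le_of_lt (degree_le_of_natDegree_le h1) ?_
    simp only [s, Finset.card_range]
    exact_mod_cast Nat.lt_succ_self k
  have hP : P = Lagrange.interpolate s v (fun i => P.eval (v i)) :=
    Lagrange.eq_interpolate hv hdeg
  have hfac : ∀ n : ℕ, ∏ i ∈ Finset.range n, ((i : ℝ) + 1) = n.factorial := by
    intro n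
    rw [← Finset.prod_range_add_one_eq_factorial]
    push_cast
    rfl
  have hk : (k.factorial : ℝ) ≠ 0 := by exact_mod_cast k.factorial_ne_zero
  refine ⟨fun j => Lagrange.nodalWeight s v j * P.eval (v j), ?_, ?_⟩
  · have h1 : Lagrange.nodalWeight s v 0 = (k.factorial : ℝ)⁻¹ := by
      rw [Lagrange.nodalWeight, Finset.prod_inv_distrib, ← hfac]
      congr 1
      have : s.erase 0 = (Finset.range k).image Nat.succ := by
        ext x
        cases x <;> simp [s]
      rw [this, Finset.prod_image (by intro x _ y _ h; exact Nat.succ.inj h)]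
      refine Finset.prod_congr rfl fun i _ => ?_
      simp [v]
    have h2 : ∏ i ∈ Finset.range k, (((i : ℝ) + 1) - v 0) = (k + 1).factorial := by
      rw [← hfac, Finset.prod_range_succ']
      simp [v]
    simp only [h1, hev, h2, Nat.factorial_succ]
    push_cast
    field_simp
  · intro i hi
    have hne : ∀ j ∈ s, (i : ℝ) ≠ v j := by
      intro j _
      have : (0 : ℝ) < (i : ℝ) + j + 1 := by positivity
      simp only [v]
      intro h
      linarith
    have key := Lagrange.eval_interpolate_not_at_node (fun i => P.eval (v i)) hne
    rw [← hP] at key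
    have hs : ∑ j ∈ s, Lagrange.nodalWeight s v j * ((i : ℝ) - v j)⁻¹ * P.eval (v j) =
        ∑ j ∈ s, Lagrange.nodalWeight s v j * P.eval (v j) / ((i : ℝ) + j + 1) := by
      refine Finset.sum_congr rfl fun j _ => ?_
      have : (i : ℝ) - v j = (i : ℝ) + j + 1 := by simp only [v]; ring
      rw [this]; ring
    rw [hs] at key
    have hn : (Lagrange.nodal s v).eval (i : ℝ) ≠ 0 := by
      rw [Lagrange.eval_nodal, Finset.prod_ne_zero_iff]
      intro j hj
      exact sub_ne_zero.2 (hne j hj)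
    change ∑ j ∈ s, Lagrange.nodalWeight s v j * P.eval (v j) / ((i : ℝ) + j + 1) = _
    apply mul_left_cancel₀ hn
    rw [← key, hev]
    split_ifs with h0
    · subst h0
      have : (Lagrange.nodal s v).eval ((0 : ℕ) : ℝ) = (k + 1).factorial := by
        rw [Lagrange.eval_nodal, ← hfac]
        refine Finset.prod_congr rfl fun i _ => ?_
        simp [v]
      rw [this]
      simp only [Nat.cast_zero, sub_zero, hfac, Nat.factorial_succ]
      push_cast
      ring
    · have : ∏ m ∈ Finset.range k, (((m : ℝ) + 1) - (i : ℝ)) = 0 := by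
        apply Finset.prod_eq_zero (i := i - 1)
        · simp only [Finset.mem_range] at hi ⊢
          omega
        · have : ((i - 1 : ℕ) : ℝ) = (i : ℝ) - 1 := by
            rw [Nat.cast_sub (by omega)]; simp
          rw [this]; ring
      rw [this]; simp

open Polynomial in
lemma unit_bound (k : ℕ) (g : ℝ[X]) (hg : g.natDegree ≤ k) :
    (g.eval 0) ^ 2 ≤ ((k : ℝ) + 1) ^ 2 * ∫ t in (0 : ℝ)..1, (g.eval t) ^ 2 := by
  obtain ⟨c, hc0, hc⟩ := kernel_coeffs k
  let K : ℝ[X] := ∑ j ∈ Finset.range (k + 1), C (c j) * X ^ j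
  have hK : K.natDegree ≤ k := by
    apply natDegree_sum_le_of_forall_le
    intro j hj
    refine (natDegree_C_mul_X_pow_le _ _).trans ?_
    simp only [Finset.mem_range] at hj
    omega
  have hKe : ∀ t, K.eval t = ∑ j ∈ Finset.range (k + 1), c j * t ^ j := by
    intro t
    simp [K, eval_finsetSum]
  have hrep : ∀ p : ℝ[X], p.natDegree ≤ k →
      ∫ t in (0 : ℝ)..1, p.eval t * K.eval t = p.eval 0 := by
    intro p hp
    have h1 : ∀ t, p.eval t * K.eval t = ∑ i ∈ Finset.range (k + 1),
        ∑ j ∈ Finset.range (k + 1), p.coeff i * c j * t ^ (i + j) := by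
      intro t
      rw [eval_eq_sum_range' (Nat.lt_succ_of_le hp), hKe, Finset.sum_mul_sum]
      refine Finset.sum_congr rfl fun i _ => Finset.sum_congr rfl fun j _ => ?_
      rw [pow_add]; ring
    simp_rw [h1]
    rw [intervalIntegral.integral_finsetSum
      (fun i _ => Continuous.intervalIntegrable (by fun_prop) _ _)]
    have h2 : ∀ i ∈ Finset.range (k + 1),
        ∫ t in (0 : ℝ)..1, ∑ j ∈ Finset.range (k + 1), p.coeff i * c j * t ^ (i + j) =
        p.coeff i * if i = 0 then 1 else 0 := by
      intro i hi
      rw [← hc i hi, intervalIntegral.integral_finsetSum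
        (fun i _ => Continuous.intervalIntegrable (by fun_prop) _ _), Finset.mul_sum]
      refine Finset.sum_congr rfl fun j _ => ?_
      rw [intervalIntegral.integral_const_mul, integral_pow]
      push_cast
      simp
      ring
    rw [Finset.sum_congr rfl h2]
    simp [coeff_zero_eq_eval_zero]
  have hK0 : K.eval 0 = ((k : ℝ) + 1) ^ 2 := by
    rw [hKe, Finset.sum_range_succ', ← hc0]
    simp
  have hpos : (0 : ℝ) < ((k : ℝ) + 1) ^ 2 := by positivity
  set s := g.eval 0 / ((k : ℝ) + 1) ^ 2 with hs
  have h0 : 0 ≤ ∫ t in (0 : ℝ)..1, (g.eval t - s * K.eval t) ^ 2 :=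
    intervalIntegral.integral_nonneg zero_le_one (fun t _ => sq_nonneg _)
  have hexp : ∀ t, (g.eval t - s * K.eval t) ^ 2 =
      (g.eval t) ^ 2 - (2 * s) * (g.eval t * K.eval t) + s ^ 2 * (K.eval t * K.eval t) := by
    intro t; ring
  simp_rw [hexp] at h0
  have hgc : Continuous fun t => g.eval t := g.continuous
  have hKc : Continuous fun t => K.eval t := K.continuous
  rw [intervalIntegral.integral_add (Continuous.intervalIntegrable (by fun_prop) _ _)
    (Continuous.intervalIntegrable (by fun_prop) _ _),
    intervalIntegral.integral_sub (Continuous.intervalIntegrable (by fun_prop) _ _)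
    (Continuous.intervalIntegrable (by fun_prop) _ _),
    intervalIntegral.integral_const_mul, intervalIntegral.integral_const_mul,
    hrep g hg, hrep K hK, hK0] at h0
  have hgs : g.eval 0 = s * ((k : ℝ) + 1) ^ 2 := by rw [hs]; field_simp
  rw [hgs] at h0 ⊢
  nlinarith [mul_nonneg hpos.le h0]

/-- Appendix A: the discrete trace inequality
`|f(a)| ≤ ((k+1)/√(b-a)) ‖f‖_{L²(a,b)}` for polynomials of degree at most `k`. -/
theorem polynomial_endpoint_bound (a b : ℝ) (hab : a < b) (k : ℕ)
    (f : Polynomial ℝ) (hf : f.natDegree ≤ k) :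
    |f.eval a| ≤ (((k : ℝ) + 1) / Real.sqrt (b - a)) *
      Real.sqrt (∫ t in a..b, (f.eval t) ^ 2) := by
  have hd : 0 < b - a := sub_pos.2 hab
  have h := unit_bound k (f.comp (Polynomial.C (b - a) * Polynomial.X + Polynomial.C a)) (by
    refine Polynomial.natDegree_comp_le.trans ?_
    refine (Nat.mul_le_mul hf Polynomial.natDegree_linear_le).trans (by simp))
  simp only [Polynomial.eval_comp, Polynomial.eval_add, Polynomial.eval_mul, Polynomial.eval_C,
    Polynomial.eval_X, mul_zero, zero_add] at h
  rw [intervalIntegral.integral_comp_mul_add (fun t => (f.eval t) ^ 2) hd.ne' a] at h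
  simp only [mul_zero, zero_add, mul_one, sub_add_cancel, smul_eq_mul] at h
  have hI : 0 ≤ ∫ t in a..b, (f.eval t) ^ 2 :=
    intervalIntegral.integral_nonneg hab.le (fun t _ => sq_nonneg _)
  apply abs_le_of_sq_le_sq _ (by positivity)
  rw [mul_pow, div_pow, Real.sq_sqrt hd.le, Real.sq_sqrt hI]
  refine h.trans (le_of_eq ?_)
  field_simp
end

section
/- Let a < b be real numbers and k ∈ ℕ. For every constant C < (k+1)/√(b−a) there exists a real polynomial f of degree at most k such that C · (∫_a^b f(t)² dt)^{1/2} < |f(a)|. -/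
open Polynomial in
/-- Extremal polynomial on the unit interval. -/
theorem exists_extremal_unit (k : ℕ) : ∃ g : Polynomial ℝ, g.natDegree ≤ k ∧
    (∫ t in (0:ℝ)..1, (g.eval t) ^ 2) = 1 ∧ |g.eval 0| = (k : ℝ) + 1 := by
  set v : ℕ → ℝ := fun j => -((j : ℝ) + 1) with hv
  set s := Finset.range (k + 1) with hs
  set N : Polynomial ℝ := Lagrange.nodal (Finset.range k) (fun i : ℕ => (i : ℝ) + 1) with hN
  set r : ℕ → ℝ := fun j => Lagrange.nodalWeight s v j * N.eval (v j) with hr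
  have hinj : Set.InjOn v s := by
    intro x _ y _ h
    simpa [hv] using h
  have hdeg : N.degree < (s.card : ℕ) := by
    rw [hN, Lagrange.degree_nodal, hs]
    simp only [Finset.card_range]
    exact_mod_cast Nat.lt_succ_self k
  have hint : N = Lagrange.interpolate s v (fun i => N.eval (v i)) :=
    Lagrange.eq_interpolate hinj hdeg
  have key : ∀ m : ℕ, N.eval (m : ℝ) =
      (Lagrange.nodal s v).eval (m : ℝ) * ∑ j ∈ s, r j / ((m : ℝ) + j + 1) := by
    intro m
    conv_lhs => rw [hint]
    rw [Lagrange.eval_interpolate_not_at_node]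
    · congr 1
      refine Finset.sum_congr rfl fun j _ => ?_
      simp only [hr, hv]
      rw [show (m : ℝ) - -((j : ℝ) + 1) = m + j + 1 by ring]
      ring
    · intro j _
      simp only [hv]
      have : (0 : ℝ) ≤ m := m.cast_nonneg
      have : (0 : ℝ) ≤ j := j.cast_nonneg
      intro h
      linarith
  have hnod : ∀ m : ℕ, (Lagrange.nodal s v).eval (m : ℝ) ≠ 0 := by
    intro m
    rw [Lagrange.eval_nodal, Finset.prod_ne_zero_iff]
    intro j _
    simp only [hv]
    have : (0 : ℝ) ≤ m := m.cast_nonneg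
    have : (0 : ℝ) ≤ j := j.cast_nonneg
    intro h
    linarith
  have hzero : ∀ m ∈ s, m ≠ 0 → ∑ j ∈ s, r j / ((m : ℝ) + j + 1) = 0 := by
    intro m hm hm0
    have h := key m
    have h0 : N.eval (m : ℝ) = 0 := by
      obtain ⟨n, rfl⟩ := Nat.exists_eq_succ_of_ne_zero hm0
      rw [hN, Lagrange.eval_nodal]
      refine Finset.prod_eq_zero (i := n) ?_ (by push_cast; ring)
      simp [hs] at hm ⊢
      omega
    rw [h0] at h
    exact (mul_eq_zero.mp h.symm).resolve_left (hnod m)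
  have hfac : ∀ n : ℕ, ∏ i ∈ Finset.range n, ((i : ℝ) + 1) = (n.factorial : ℝ) := by
    intro n
    rw [← Finset.prod_range_add_one_eq_factorial]
    push_cast
    rfl
  have hN0 : N.eval 0 = (-1) ^ k * (k.factorial : ℝ) := by
    rw [hN, Lagrange.eval_nodal, ← hfac]
    simp only [zero_sub]
    rw [Finset.prod_neg]
    simp
  have hN1 : N.eval (v 0) = (-1) ^ k * ((k + 1).factorial : ℝ) := by
    rw [hN, Lagrange.eval_nodal, ← hfac, Finset.prod_range_succ']
    have : ∀ i ∈ Finset.range k, v 0 - ((i : ℝ) + 1) = -(((i + 1 : ℕ) : ℝ) + 1) := by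
      intro i _
      simp only [hv]
      push_cast
      ring
    rw [Finset.prod_congr rfl this, Finset.prod_neg]
    simp
  have hnod0 : (Lagrange.nodal s v).eval 0 = ((k + 1).factorial : ℝ) := by
    rw [Lagrange.eval_nodal, ← hfac]
    simp [hv, hs]
  have hw : Lagrange.nodalWeight s v 0 = (k.factorial : ℝ)⁻¹ := by
    rw [Lagrange.nodalWeight, ← hfac, Finset.prod_inv_distrib]
    congr 1
    have : s.erase 0 = (Finset.range k).map ⟨Nat.succ, Nat.succ_injective⟩ := by
      ext x
      simp only [hs, Finset.mem_erase, Finset.mem_range, Finset.mem_map, Function.Embedding.coeFn_mk]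
      constructor
      · rintro ⟨h1, h2⟩
        exact ⟨x - 1, by omega, by omega⟩
      · rintro ⟨y, h1, rfl⟩
        omega
    rw [this, Finset.prod_map]
    refine Finset.prod_congr rfl fun i _ => ?_
    simp [hv]
  have hkf : (k.factorial : ℝ) ≠ 0 := by exact_mod_cast k.factorial_ne_zero
  have hk1 : ((k + 1).factorial : ℝ) = ((k : ℝ) + 1) * k.factorial := by
    rw [Nat.factorial_succ]
    push_cast
    rfl
  have hk0 : (k : ℝ) + 1 ≠ 0 := by positivity
  have hr0 : r 0 = (-1) ^ k * ((k : ℝ) + 1) := by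
    simp only [hr]
    rw [hw, hN1, hk1]
    field_simp
  have hR0 : ∑ j ∈ s, r j / (((0 : ℕ) : ℝ) + j + 1) = (-1) ^ k / ((k : ℝ) + 1) := by
    have h := key 0
    rw [Nat.cast_zero, hN0, hnod0, hk1] at h
    rw [Nat.cast_zero, eq_div_iff hk0]
    apply mul_right_cancel₀ hkf
    rw [h]
    ring
  have hmem : 0 ∈ s := by simp [hs]
  refine ⟨∑ j ∈ s, C (r j) * X ^ j, ?_, ?_, ?_⟩
  · refine natDegree_sum_le_of_forall_le _ _ fun j hj => ?_
    refine (natDegree_C_mul_X_pow_le _ _).trans ?_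
    simp [hs] at hj
    omega
  · have h1 : ∀ t : ℝ, (eval t (∑ j ∈ s, C (r j) * X ^ j)) ^ 2 =
        ∑ i ∈ s, ∑ j ∈ s, r i * r j * t ^ (i + j) := by
      intro t
      simp only [eval_finsetSum, eval_mul, eval_C, eval_pow, eval_X]
      rw [sq, Finset.sum_mul_sum]
      refine Finset.sum_congr rfl fun i _ => Finset.sum_congr rfl fun j _ => ?_
      ring
    simp only [h1]
    rw [intervalIntegral.integral_finsetSum
      (fun i _ => Continuous.intervalIntegrable (by fun_prop) _ _)]
    have h2 : ∀ i ∈ s, (∫ t in (0:ℝ)..1, ∑ j ∈ s, r i * r j * t ^ (i + j)) =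
        r i * ∑ j ∈ s, r j / ((i : ℝ) + j + 1) := by
      intro i _
      rw [intervalIntegral.integral_finsetSum
        (fun i _ => Continuous.intervalIntegrable (by fun_prop) _ _), Finset.mul_sum]
      refine Finset.sum_congr rfl fun j _ => ?_
      rw [intervalIntegral.integral_const_mul, integral_pow]
      simp
      ring
    rw [Finset.sum_congr rfl h2, Finset.sum_eq_single_of_mem 0 hmem
      (fun i hi hi0 => by rw [hzero i hi hi0, mul_zero]), hR0, hr0]
    field_simp
    rw [← pow_mul, mul_comm, pow_mul]
    simp
  · have : eval 0 (∑ j ∈ s, C (r j) * X ^ j) = r 0 := by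
      simp only [eval_finsetSum, eval_mul, eval_C, eval_pow, eval_X]
      rw [Finset.sum_eq_single_of_mem 0 hmem (fun i _ hi0 => by simp [hi0])]
      simp
    rw [this, hr0, abs_mul, abs_pow, abs_neg, abs_one, one_pow, one_mul]
    exact abs_of_nonneg (by positivity)

/-- Appendix A, optimality: the constant `(k+1)/√(b-a)` in the discrete trace
inequality `|f(a)| ≤ ((k+1)/√(b-a)) ‖f‖_{L²(a,b)}` is sharp. -/
theorem polynomial_endpoint_bound_optimal (a b : ℝ) (hab : a < b) (k : ℕ)
    (C : ℝ) (hC : C < ((k : ℝ) + 1) / Real.sqrt (b - a)) :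
    ∃ f : Polynomial ℝ, f.natDegree ≤ k ∧
      C * Real.sqrt (∫ t in a..b, (f.eval t) ^ 2) < |f.eval a| := by
  obtain ⟨g, hg, hi, h0⟩ := exists_extremal_unit k
  have hpos : 0 < b - a := sub_pos.mpr hab
  refine ⟨g.comp (Polynomial.C ((b - a)⁻¹) * (Polynomial.X - Polynomial.C a)), ?_, ?_⟩
  · rw [Polynomial.natDegree_comp]
    have : (Polynomial.C ((b - a)⁻¹) * (Polynomial.X - Polynomial.C a)).natDegree ≤ 1 := by
      refine (Polynomial.natDegree_C_mul_le _ _).trans ?_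
      simp
    calc _ ≤ g.natDegree * 1 := Nat.mul_le_mul_left _ this
      _ ≤ k := by simpa using hg
  · have h1 : (∫ t in a..b, ((g.comp (Polynomial.C ((b - a)⁻¹) *
        (Polynomial.X - Polynomial.C a))).eval t) ^ 2) = b - a := by
      have h := intervalIntegral.integral_comp_mul_sub (a := a) (b := b)
        (fun t => (g.eval t) ^ 2) (inv_ne_zero hpos.ne') ((b - a)⁻¹ * a)
      rw [sub_self, ← mul_sub, inv_mul_cancel₀ hpos.ne', hi] at h
      simp only [Polynomial.eval_comp, Polynomial.eval_mul, Polynomial.eval_C,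
        Polynomial.eval_sub, Polynomial.eval_X, mul_sub]
      simp only [← mul_sub] at h ⊢
      rw [h]
      simp
    rw [h1]
    simp only [Polynomial.eval_comp, Polynomial.eval_mul, Polynomial.eval_C,
        Polynomial.eval_sub, Polynomial.eval_X, sub_self, mul_zero, h0]
    exact (lt_div_iff₀ (Real.sqrt_pos.mpr hpos)).mp hC
end

section
/- Let P₀, P₁, …, Pₙ be n+1 affinely independent points in ℝⁿ (n ≥ 1), K = conv{P₀, …, Pₙ} the n-simplex with volume |K| > 0 (Lebesgue measure), and for each k let F_k = conv{P_j : j ≠ k} be the side opposite P_k, equipped with (n−1)-dimensional Hausdorff measure. Then every affine function f : ℝⁿ → ℝ satisfies (n/2) · max_{j=0,…,n} (⨍_{F_j} f dH^{n−1})² ≤ ((n+1)/|K|) · ∫_K f² dx. -/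
open MeasureTheory
set_option linter.unusedSectionVars false
section
variable {E ι : Type*} [NormedAddCommGroup E] [NormedSpace ℝ E] [FiniteDimensional ℝ E]
  [MeasurableSpace E] [BorelSpace E] [Fintype ι] [DecidableEq ι]

lemma aux_cv (μ : Measure E) [μ.IsAddHaarMeasure] (T : E →ᵃ[ℝ] E) (hT : Function.Injective T) :
    ∃ c : ℝ, ∀ (s : Set E), MeasurableSet s → ∀ g : E → ℝ,
      ∫ x in T '' s, g x ∂μ = c * ∫ x in s, g (T x) ∂μ := by
  refine ⟨|(LinearMap.toContinuousLinearMap T.linear).det|, fun s hs g => ?_⟩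
  rw [integral_image_eq_integral_abs_det_fderiv_smul (f' := fun _ => LinearMap.toContinuousLinearMap T.linear) μ hs ?_ hT.injOn]
  · simp only [smul_eq_mul]
    rw [integral_const_mul]
  · intro x _
    have h : (T : E → E) = fun x => LinearMap.toContinuousLinearMap T.linear x + T 0 := by
      funext y
      rw [AffineMap.decomp T]; simp
    rw [h]
    exact ((LinearMap.toContinuousLinearMap T.linear).hasFDerivAt.add_const _).hasFDerivWithinAt

/-- shear in direction `b i - b j` -/
noncomputable def shearMap (b : AffineBasis ι ℝ E) (i j : ι) (h : E →ᵃ[ℝ] ℝ) : E →ᵃ[ℝ] E :=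
  AffineMap.id ℝ E + (LinearMap.toAffineMap (LinearMap.toSpanSingleton ℝ E (b i - b j))).comp h

lemma coord_shear (b : AffineBasis ι ℝ E) (i j k : ι) (h : E →ᵃ[ℝ] ℝ) (x : E) :
    b.coord k (shearMap b i j h x) = b.coord k x +
      h x * ((if k = i then 1 else 0) - (if k = j then 1 else 0)) := by
  have h1 : shearMap b i j h x = (h x • (b i -ᵥ b j)) +ᵥ x := by
    simp [shearMap, add_comm]
  rw [h1, AffineMap.map_vadd, map_smul, AffineMap.linearMap_vsub]
  simp [AffineBasis.coord_apply, add_comm]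

lemma isCompact_K (b : AffineBasis ι ℝ E) : IsCompact (convexHull ℝ (Set.range b)) :=
  (Set.finite_range b).isCompact_convexHull ℝ

lemma mem_K (b : AffineBasis ι ℝ E) (x : E) :
    x ∈ convexHull ℝ (Set.range b) ↔ ∀ i, 0 ≤ b.coord i x := by
  rw [AffineBasis.convexHull_eq_nonneg_coord]; rfl

lemma cont_coord (b : AffineBasis ι ℝ E) (i : ι) : Continuous (b.coord i) :=
  AffineMap.continuous_of_finiteDimensional _

lemma vol_pos (μ : Measure E) [μ.IsAddHaarMeasure] (b : AffineBasis ι ℝ E) :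
    0 < (μ (convexHull ℝ (Set.range b))).toReal := by
  refine ENNReal.toReal_pos ?_ (isCompact_K b).measure_lt_top.ne
  refine (Measure.measure_pos_of_nonempty_interior μ ?_).ne'
  exact ⟨_, b.centroid_mem_interior_convexHull⟩

lemma aff_expand (b : AffineBasis ι ℝ E) (f : E →ᵃ[ℝ] ℝ) (x : E) :
    f x = ∑ i, b.coord i x * f (b i) := by
  conv_lhs => rw [← b.affineCombination_coord_eq_self x]
  rw [Finset.map_affineCombination _ _ _ (b.sum_coord_apply_eq_one x),
    Finset.affineCombination_eq_linear_combination _ _ _ (b.sum_coord_apply_eq_one x)]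
  simp

lemma swap_inv (μ : Measure E) [μ.IsAddHaarMeasure] (b : AffineBasis ι ℝ E) (i j : ι) (hij : i ≠ j)  :
    ∃ T : E →ᵃ[ℝ] E, (∀ x, b.coord i (T x) = b.coord j x) ∧ (∀ x, b.coord j (T x) = b.coord i x) ∧
     (∀ k x, k ≠ i → k ≠ j → b.coord k (T x) = b.coord k x) ∧ (∀ x, T (T x) = x) ∧
     T '' convexHull ℝ (Set.range b) = convexHull ℝ (Set.range b) ∧
     ∀ s, MeasurableSet s → ∀ g : E → ℝ, ∫ x in T '' s, g x ∂μ = ∫ x in s, g (T x) ∂μ := by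
  set T := shearMap b i j (b.coord j - b.coord i) with hTd
  have hi : ∀ x, b.coord i (T x) = b.coord j x := by
    intro x; rw [coord_shear]; simp [hij]
  have hj : ∀ x, b.coord j (T x) = b.coord i x := by
    intro x; rw [coord_shear]; simp [hij.symm]
  have hk : ∀ k x, k ≠ i → k ≠ j → b.coord k (T x) = b.coord k x := by
    intro k x h1 h2; rw [coord_shear]; simp [h1, h2]
  have hTT : ∀ x, T (T x) = x := by
    intro x
    apply b.ext_elem
    intro k
    by_cases h1 : k = i
    · subst h1; rw [hi, hj]
    by_cases h2 : k = j
    · subst h2; rw [hj, hi]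
    rw [hk k _ h1 h2, hk k _ h1 h2]
  refine ⟨T, hi, hj, hk, hTT, ?_⟩
  obtain ⟨c, hc⟩ := aux_cv μ T (Function.LeftInverse.injective hTT)
  have hTK : T '' convexHull ℝ (Set.range b) = convexHull ℝ (Set.range b) := by
    have hsub : ∀ x ∈ convexHull ℝ (Set.range b), T x ∈ convexHull ℝ (Set.range b) := by
      intro x hx
      rw [mem_K] at hx ⊢
      intro k
      by_cases h1 : k = i
      · subst h1; rw [hi]; exact hx _
      by_cases h2 : k = j
      · subst h2; rw [hj]; exact hx _
      rw [hk k _ h1 h2]; exact hx _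
    ext x
    constructor
    · rintro ⟨y, hy, rfl⟩; exact hsub y hy
    · intro hx; exact ⟨T x, hsub x hx, hTT x⟩
  have h1 := hc _ (isCompact_K b).measurableSet (fun _ => 1)
  rw [hTK] at h1
  have hv := vol_pos μ b
  have hc1 : c = 1 := by
    simp only [integral_const, smul_eq_mul, mul_one, Measure.real, MeasurableSet.univ, Measure.restrict_apply, Set.univ_inter] at h1
    exact (mul_right_cancel₀ hv.ne' (by rw [one_mul]; exact h1)).symm
  refine ⟨hTK, ?_⟩
  intro s hs g
  rw [hc s hs g, hc1, one_mul]

lemma diag_null (μ : Measure E) [μ.IsAddHaarMeasure] (b : AffineBasis ι ℝ E) (i j : ι) (hij : i ≠ j) :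
    μ {x | b.coord i x = b.coord j x} = 0 := by
  have h := Measure.addHaar_affineSubspace μ
    ((AffineSubspace.mk' (0:ℝ) ⊥).comap (b.coord i - b.coord j)) (by
      intro h
      have : b i ∈ ((AffineSubspace.mk' (0:ℝ) ⊥).comap (b.coord i - b.coord j)) := by
        rw [h]; trivial
      simp [AffineSubspace.mem_mk', hij.symm, AffineBasis.coord_apply] at this)
  convert h using 2
  ext x
  simp [AffineSubspace.mem_mk', sub_eq_zero]

lemma int_K (μ : Measure E) [μ.IsAddHaarMeasure] (b : AffineBasis ι ℝ E) (g : E → ℝ)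
    (hg : Continuous g) : IntegrableOn g (convexHull ℝ (Set.range b)) μ :=
  hg.continuousOn.integrableOn_compact (isCompact_K b)

lemma half_inv (μ : Measure E) [μ.IsAddHaarMeasure] (b : AffineBasis ι ℝ E) (i j : ι) (hij : i ≠ j) :
    ∫ x in convexHull ℝ (Set.range b), b.coord i x * b.coord i x ∂μ =
     2 * ∫ x in convexHull ℝ (Set.range b), b.coord i x * b.coord j x ∂μ := by
  obtain ⟨T, hi, hj, hk, hTT, hTK, hT⟩ := swap_inv μ b i j hij
  set S := shearMap b i j ((1/2:ℝ) • b.coord j) with hSd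
  set K := convexHull ℝ (Set.range b) with hKd
  have hSi : ∀ x, b.coord i (S x) = b.coord i x + b.coord j x / 2 := by
    intro x; rw [coord_shear]; simp [hij]; ring
  have hSj : ∀ x, b.coord j (S x) = b.coord j x / 2 := by
    intro x; rw [coord_shear]; simp [hij.symm]; ring
  have hSk : ∀ k x, k ≠ i → k ≠ j → b.coord k (S x) = b.coord k x := by
    intro k x h1 h2; rw [coord_shear]; simp [h1, h2]
  set S' := shearMap b i j (-b.coord j) with hSd'
  have hSS : ∀ x, S' (S x) = x := by
    intro x
    apply b.ext_elem
    intro k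
    rw [coord_shear, coord_shear]
    have e1 : (-b.coord j) (S x) = -(b.coord j x / 2) := by rw [← hSj]; rfl
    have e2 : ((1/2:ℝ) • b.coord j) x = b.coord j x / 2 := by
      show (1/2:ℝ) * b.coord j x = _
      ring
    rw [e1, e2]
    ring
  have hSS' : ∀ x, S (S' x) = x := by
    intro x
    apply b.ext_elem
    intro k
    rw [coord_shear, coord_shear]
    have e1 : (-b.coord j) x = -(b.coord j x) := rfl
    have e2 : ((1/2:ℝ) • b.coord j) (S' x) = b.coord j x := by
      show (1/2:ℝ) * b.coord j (S' x) = _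
      rw [coord_shear, e1]
      simp [hij.symm]
      ring
    rw [e1, e2]
    ring
  obtain ⟨c, hc⟩ := aux_cv μ S (Function.LeftInverse.injective hSS)
  set H := K ∩ {x | b.coord j x ≤ b.coord i x} with hH
  set H' := K ∩ {x | b.coord i x ≤ b.coord j x} with hH'
  have hKm : MeasurableSet K := (isCompact_K b).measurableSet
  have hHm : MeasurableSet H := hKm.inter (isClosed_le (cont_coord b j) (cont_coord b i)).measurableSet
  have hHm' : MeasurableSet H' := hKm.inter (isClosed_le (cont_coord b i) (cont_coord b j)).measurableSet
  have hSK : S '' K = H := by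
    ext x
    constructor
    · rintro ⟨y, hy, rfl⟩
      rw [mem_K] at hy
      refine ⟨?_, ?_⟩
      · rw [hKd, mem_K]
        intro k
        by_cases h1 : k = i
        · subst h1; rw [hSi]; have := hy k; have := hy j; positivity
        by_cases h2 : k = j
        · subst h2; rw [hSj]; have := hy k; positivity
        rw [hSk k _ h1 h2]; exact hy _
      · show b.coord j (S y) ≤ b.coord i (S y)
        rw [hSi, hSj]; linarith [hy i]
    · rintro ⟨hx, hx2⟩
      rw [hKd, mem_K] at hx
      refine ⟨S' x, ?_, hSS' x⟩
      rw [hKd, mem_K]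
      intro k
      have hx2 : b.coord j x ≤ b.coord i x := hx2
      rw [coord_shear]
      by_cases h1 : k = i
      · subst h1; simp [hij]; exact hx2
      by_cases h2 : k = j
      · subst h2; simp [hij.symm]; exact hx k
      simp [h1, h2]; exact hx k
  have hTH : T '' H = H' := by
    have key : ∀ x, T x ∈ K ↔ x ∈ K := by
      intro x
      constructor
      · intro h
        rw [← hTK] at h
        obtain ⟨y, hy, hxy⟩ := h
        rw [← hTT x, ← hxy, hTT]; exact hy
      · intro h; rw [← hTK]; exact ⟨x, h, rfl⟩
    ext x
    constructor
    · rintro ⟨y, ⟨hy, hy2⟩, rfl⟩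
      refine ⟨(key y).2 hy, ?_⟩
      show b.coord i (T y) ≤ b.coord j (T y)
      rw [hi, hj]; exact hy2
    · rintro ⟨hx, hx2⟩
      refine ⟨T x, ⟨(key x).2 hx, ?_⟩, hTT x⟩
      show b.coord j (T x) ≤ b.coord i (T x)
      rw [hi, hj]; exact hx2
  have hU : H ∪ H' = K := by
    ext x
    simp only [hH, hH', Set.mem_union, Set.mem_inter_iff, Set.mem_ofPred_eq]
    have := le_total (b.coord j x) (b.coord i x)
    tauto
  have hD : AEDisjoint μ H H' := by
    refine measure_mono_null ?_ (diag_null μ b i j hij)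
    rintro x ⟨⟨_, h1⟩, ⟨_, h2⟩⟩
    exact le_antisymm h2 h1
  have main : ∀ g : E → ℝ, Continuous g → (∀ x, g (T x) = g x) →
      ∫ x in K, g x ∂μ = 2 * c * ∫ x in K, g (S x) ∂μ := by
    intro g hg hgT
    have hgi := int_K μ b g hg
    have h1 : ∫ x in K, g x ∂μ = ∫ x in H, g x ∂μ + ∫ x in H', g x ∂μ := by
      rw [← hU]
      exact integral_union_ae hD hHm'.nullMeasurableSet (hgi.mono_set Set.inter_subset_left)
        (hgi.mono_set Set.inter_subset_left)
    have h2 : ∫ x in H', g x ∂μ = ∫ x in H, g x ∂μ := by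
      rw [← hTH, hT H hHm g]
      simp only [hgT]
    have h3 : ∫ x in H, g x ∂μ = c * ∫ x in K, g (S x) ∂μ := by
      rw [← hSK, hc K hKm g]
    rw [h1, h2, h3]; ring
  have hc1 : 2 * c = 1 := by
    have h1 := main (fun _ => 1) continuous_const (fun _ => rfl)
    have hv := vol_pos μ b
    simp only [integral_const, smul_eq_mul, mul_one, Measure.real, MeasurableSet.univ, Measure.restrict_apply, Set.univ_inter] at h1
    exact (mul_right_cancel₀ hv.ne' (by rw [one_mul]; exact h1)).symm
  have h2 := main (fun x => b.coord i x * b.coord j x) ((cont_coord b i).mul (cont_coord b j))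
    (fun x => by simp only [hi, hj]; ring)
  rw [hc1, one_mul] at h2
  have h3 : ∫ x in K, b.coord i (S x) * b.coord j (S x) ∂μ =
     (1/2) * ∫ x in K, b.coord i x * b.coord j x ∂μ + (1/4) * ∫ x in K, b.coord j x * b.coord j x ∂μ := by
    rw [← integral_const_mul, ← integral_const_mul, ← integral_add]
    · congr 1
      funext x
      rw [hSi, hSj]; ring
    · exact (int_K μ b _ ((cont_coord b i).mul (cont_coord b j))).const_mul _
    · exact (int_K μ b _ ((cont_coord b j).mul (cont_coord b j))).const_mul _
  have h4 : ∫ x in K, b.coord i x * b.coord i x ∂μ = ∫ x in K, b.coord j x * b.coord j x ∂μ := by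
    conv_lhs => rw [← hTK, hT K hKm]
    simp only [hi]
  rw [h4]
  linarith

lemma mean_K (μ : Measure E) [μ.IsAddHaarMeasure] (b : AffineBasis ι ℝ E) (f : E →ᵃ[ℝ] ℝ) :
    (μ (convexHull ℝ (Set.range b))).toReal⁻¹ * ∫ x in convexHull ℝ (Set.range b), f x ∂μ
      = (∑ i, f (b i)) / Fintype.card ι := by
  set K := convexHull ℝ (Set.range b) with hKd
  have hKm : MeasurableSet K := (isCompact_K b).measurableSet
  have hV := vol_pos μ b
  rw [← hKd] at hV
  have hN : (Fintype.card ι : ℝ) ≠ 0 := by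
    have := b.nonempty
    exact_mod_cast Fintype.card_ne_zero
  have hs : ∀ i j, ∫ x in K, b.coord i x ∂μ = ∫ x in K, b.coord j x ∂μ := by
    intro i j
    by_cases hij : i = j
    · rw [hij]
    obtain ⟨T, hi, hj, hk, hTT, hTK, hT⟩ := swap_inv μ b i j hij
    rw [← hKd] at hTK
    conv_lhs => rw [← hTK, hT K hKm]
    simp only [hi]
  have hsum : ∑ i, ∫ x in K, b.coord i x ∂μ = (μ K).toReal := by
    rw [← integral_finsetSum _ (fun i _ => int_K μ b _ (cont_coord b i))]
    simp [Measure.real, ← hKd]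
  have hone : ∀ i, ∫ x in K, b.coord i x ∂μ = (μ K).toReal / Fintype.card ι := by
    intro i
    rw [← hsum, Finset.sum_congr rfl (fun j _ => hs j i)]
    simp; field_simp
  have : ∫ x in K, f x ∂μ = ∑ i, (μ K).toReal / Fintype.card ι * f (b i) := by
    rw [integral_congr_ae (Filter.Eventually.of_forall (fun x => aff_expand b f x))]
    rw [integral_finsetSum _ (fun i _ => (int_K μ b _ (cont_coord b i)).mul_const _)]
    refine Finset.sum_congr rfl fun i _ => ?_
    rw [integral_mul_const, hone]
  rw [this, ← Finset.mul_sum]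
  field_simp

lemma sq_K (μ : Measure E) [μ.IsAddHaarMeasure] (b : AffineBasis ι ℝ E) (f : E →ᵃ[ℝ] ℝ) :
    (Fintype.card ι : ℝ) / (μ (convexHull ℝ (Set.range b))).toReal * ∫ x in convexHull ℝ (Set.range b), (f x) ^ 2 ∂μ
      = (∑ i, f (b i) ^ 2 + (∑ i, f (b i)) ^ 2) / (Fintype.card ι + 1) := by
  set K := convexHull ℝ (Set.range b) with hKd
  have hKm : MeasurableSet K := (isCompact_K b).measurableSet
  have hV := vol_pos μ b
  rw [← hKd] at hV
  have hN : (Fintype.card ι : ℝ) ≠ 0 := by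
    have := b.nonempty
    exact_mod_cast Fintype.card_ne_zero
  have hci : ∀ i j, IntegrableOn (fun x => b.coord i x * b.coord j x) K μ := fun i j =>
    int_K μ b _ ((cont_coord b i).mul (cont_coord b j))
  set M : ι → ι → ℝ := fun i j => ∫ x in K, b.coord i x * b.coord j x ∂μ with hM
  have hs : ∀ i j, M i i = M j j := by
    intro i j
    by_cases hij : i = j
    · rw [hij]
    obtain ⟨T, hi, hj, hk, hTT, hTK, hT⟩ := swap_inv μ b i j hij
    rw [← hKd] at hTK
    simp only [hM]
    conv_lhs => rw [← hTK, hT K hKm]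
    simp only [hi]
  obtain ⟨i0⟩ := b.nonempty
  set a := M i0 i0 with ha
  have hMM : ∀ i j, M i j = a / 2 * (1 + if i = j then 1 else 0) := by
    intro i j
    by_cases hij : i = j
    · subst hij; simp; rw [hs i i0, ← ha]; ring
    · have := half_inv μ b i j hij
      simp only [hij, if_false]
      have h2 : M i i = 2 * M i j := this
      rw [← hs i i0] at ha
      linarith
  have hsum : ∑ i, ∑ j, M i j = (μ K).toReal := by
    have : ∀ i, ∑ j, M i j = ∫ x in K, b.coord i x ∂μ := by
      intro i
      rw [← integral_finsetSum _ (fun j _ => hci i j)]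
      congr 1; funext x
      rw [← Finset.mul_sum]; simp
    simp_rw [this]
    rw [← integral_finsetSum _ (fun i _ => int_K μ b _ (cont_coord b i))]
    simp [Measure.real, ← hKd]
  have hf : ∫ x in K, (f x) ^ 2 ∂μ = ∑ i, ∑ j, M i j * (f (b i) * f (b j)) := by
    have : ∀ x, f x ^ 2 = ∑ i, ∑ j, (b.coord i x * b.coord j x) * (f (b i) * f (b j)) := by
      intro x
      rw [aff_expand b f, sq, Finset.sum_mul_sum]
      refine Finset.sum_congr rfl fun i _ => Finset.sum_congr rfl fun j _ => ?_
      ring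
    simp_rw [this]
    rw [integral_finsetSum _ (fun i _ => integrable_finsetSum _ fun j _ => (hci i j).mul_const _)]
    refine Finset.sum_congr rfl fun i _ => ?_
    rw [integral_finsetSum _ (fun j _ => (hci i j).mul_const _)]
    refine Finset.sum_congr rfl fun j _ => ?_
    rw [integral_mul_const]
  have hf2 : ∑ i, ∑ j, M i j * (f (b i) * f (b j)) = a / 2 * (∑ i, f (b i) ^ 2 + (∑ i, f (b i)) ^ 2) := by
    simp only [hMM, mul_assoc, add_mul, mul_add, Finset.sum_add_distrib, one_mul, ite_mul, zero_mul, mul_ite, mul_zero, Finset.sum_ite_eq, Finset.mem_univ, if_true, ← Finset.mul_sum]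
    rw [sq (∑ i, f (b i)), Finset.sum_mul_sum]
    simp only [← Finset.mul_sum, sq]
    ring
  have hV2 : (μ K).toReal = a / 2 * (Fintype.card ι * (Fintype.card ι + 1)) := by
    rw [← hsum]
    simp only [hMM, mul_add, Finset.sum_add_distrib, mul_ite, mul_zero, Finset.sum_ite_eq, Finset.mem_univ, if_true, Finset.sum_const, Finset.card_univ, nsmul_eq_mul]
    ring
  have hN1 : (Fintype.card ι : ℝ) + 1 ≠ 0 := by positivity
  have ha0 : a ≠ 0 := by
    intro h; rw [hV2, h] at hV; simp at hV
  rw [hf, hf2, hV2]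
  field_simp
end

lemma face_mean {n : ℕ} {ι : Type*} [Fintype ι] [DecidableEq ι] (hι : Fintype.card ι = n)
    (hn : 1 ≤ n) {E : Type*} [NormedAddCommGroup E] [InnerProductSpace ℝ E] [FiniteDimensional ℝ E]
    [MeasurableSpace E] [BorelSpace E] (Q : ι → E) (hQ : AffineIndependent ℝ Q) (f : E →ᵃ[ℝ] ℝ) :
    (μH[(n : ℝ) - 1] (convexHull ℝ (Set.range Q))).toReal⁻¹ *
            ∫ y in convexHull ℝ (Set.range Q), f y ∂(μH[(n : ℝ) - 1]) = (∑ i, f (Q i)) / n := by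
  have : Nonempty ι := Fintype.card_pos_iff.1 (by omega)
  let j0 : ι := Classical.arbitrary ι
  set V := vectorSpan ℝ (Set.range Q) with hV
  have hfr : Module.finrank ℝ V = n - 1 := hQ.finrank_vectorSpan (by omega)
  have hd : ((n : ℝ) - 1) = ((Module.finrank ℝ V : ℕ) : ℝ) := by
    rw [hfr]; push_cast [hn]; ring
  let Q' : ι → V := fun j => ⟨Q j - Q j0, vsub_mem_vectorSpan ℝ (Set.mem_range_self _) (Set.mem_range_self _)⟩
  let φ : V →ᵃ[ℝ] E := V.subtype.toAffineMap + AffineMap.const ℝ V (Q j0)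
  have hφ : ∀ v, φ v = v + Q j0 := fun v => by simp [φ]
  have hφQ : ∀ j, φ (Q' j) = Q j := fun j => by rw [hφ]; simp [Q']
  have hφQ' : φ ∘ Q' = Q := funext hφQ
  have hind : AffineIndependent ℝ Q' := AffineIndependent.of_comp φ (by rw [hφQ']; exact hQ)
  have htop : affineSpan ℝ (Set.range Q') = ⊤ := by
    rw [hind.affineSpan_eq_top_iff_card_eq_finrank_add_one, hfr]; omega
  let b : AffineBasis ι ℝ V := ⟨Q', hind, htop⟩
  have hbQ : (b : ι → V) = Q' := rfl
  have hiso : Isometry φ := by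
    refine Isometry.of_dist_eq fun x y => ?_
    rw [hφ, hφ, dist_add_right]; rfl
  have himg : convexHull ℝ (Set.range Q) = φ '' convexHull ℝ (Set.range b) := by
    rw [AffineMap.image_convexHull, ← Set.range_comp, hbQ, hφQ']
  have hd0 : (0:ℝ) ≤ Module.finrank ℝ V := by positivity
  have hemb : MeasurableEmbedding φ := hiso.isClosedEmbedding.measurableEmbedding
  have hmean := mean_K (μH[(Module.finrank ℝ V : ℝ)] : Measure V) b (f.comp φ)
  rw [hd, himg, hiso.hausdorffMeasure_image (Or.inl hd0)]
  have hres : (μH[(Module.finrank ℝ V : ℝ)] : Measure E).restrict (φ '' convexHull ℝ (Set.range b)) =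
      (Measure.map φ (μH[(Module.finrank ℝ V : ℝ)] : Measure V)).restrict (φ '' convexHull ℝ (Set.range b)) := by
    rw [hiso.map_hausdorffMeasure (Or.inl hd0), Measure.restrict_restrict_of_subset (Set.image_subset_range _ _)]
  rw [hres, hemb.setIntegral_map, Set.preimage_image_eq _ hiso.injective]
  simp only [AffineMap.comp_apply, hbQ, hφQ, hι] at hmean
  simp only [hbQ]
  exact hmean

theorem max_face_mean_sq_le (n : ℕ) (hn : 1 ≤ n)
    (P : Fin (n + 1) → EuclideanSpace ℝ (Fin n)) (hP : AffineIndependent ℝ P)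
    (hK : 0 < (volume (convexHull ℝ (Set.range P))).toReal)
    (f : EuclideanSpace ℝ (Fin n) →ᵃ[ℝ] ℝ) :
    (n : ℝ) / 2 *
        Finset.univ.sup' Finset.univ_nonempty (fun k : Fin (n + 1) =>
          ((μH[(n : ℝ) - 1] (convexHull ℝ (P '' {j | j ≠ k}))).toReal⁻¹ *
            ∫ y in convexHull ℝ (P '' {j | j ≠ k}), f y ∂(μH[(n : ℝ) - 1])) ^ 2) ≤
      ((n : ℝ) + 1) / (volume (convexHull ℝ (Set.range P))).toReal *
        ∫ x in convexHull ℝ (Set.range P), (f x) ^ 2 := by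
  have htop : affineSpan ℝ (Set.range P) = ⊤ := by
    rw [hP.affineSpan_eq_top_iff_card_eq_finrank_add_one]; simp
  let b : AffineBasis (Fin (n+1)) ℝ (EuclideanSpace ℝ (Fin n)) := ⟨P, hP, htop⟩
  have hbP : (b : Fin (n+1) → EuclideanSpace ℝ (Fin n)) = P := rfl
  have hsq := sq_K volume b f
  simp only [hbP, Fintype.card_fin] at hsq
  push_cast at hsq
  rw [hsq]
  obtain ⟨k, _, hk⟩ := Finset.exists_mem_eq_sup' (Finset.univ_nonempty (α := Fin (n+1))) (fun k : Fin (n + 1) =>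
          ((μH[(n : ℝ) - 1] (convexHull ℝ (P '' {j | j ≠ k}))).toReal⁻¹ *
            ∫ y in convexHull ℝ (P '' {j | j ≠ k}), f y ∂(μH[(n : ℝ) - 1])) ^ 2)
  rw [hk]
  have hface := face_mean (n := n) (ι := {j : Fin (n+1) // j ≠ k}) (by simp) hn (fun j => P j)
    (hP.comp_embedding (Function.Embedding.subtype _)) f
  have hr : Set.range (fun j : {j : Fin (n+1) // j ≠ k} => P j) = P '' {j | j ≠ k} := by
    ext x; simp
  rw [hr] at hface
  rw [hface]
  set F : Fin (n+1) → ℝ := fun j => f (P j) with hF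
  set t := F k
  set T := ∑ j : {j : Fin (n+1) // j ≠ k}, F j with hT
  have hS : ∑ j, F j = t + T := Fintype.sum_eq_add_sum_subtype_ne F k
  have hS2 : ∑ j, F j ^ 2 = t ^ 2 + ∑ j : {j : Fin (n+1) // j ≠ k}, F j ^ 2 :=
    Fintype.sum_eq_add_sum_subtype_ne (fun j => F j ^ 2) k
  have hcs : T ^ 2 ≤ n * ∑ j : {j : Fin (n+1) // j ≠ k}, F j ^ 2 := by
    have := sq_sum_le_card_mul_sum_sq (s := Finset.univ) (f := fun j : {j : Fin (n+1) // j ≠ k} => F j)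
    simpa using this
  show (n:ℝ)/2 * (T / n) ^ 2 ≤ (∑ j, F j ^ 2 + (∑ j, F j) ^ 2) / (n + 1 + 1)
  rw [hS, hS2]
  set W := ∑ j : {j : Fin (n+1) // j ≠ k}, F j ^ 2
  have hn0 : (0:ℝ) < n := by exact_mod_cast hn
  have e : (n:ℝ)/2 * (T / n) ^ 2 = T ^ 2 / (2 * n) := by field_simp
  rw [e, div_le_div_iff₀ (by positivity) (by positivity)]
  nlinarith [mul_nonneg hn0.le (sq_nonneg (2 * t + T))]
end

section
/- Let P₀, P₁, …, Pₙ be n+1 affinely independent points in ℝⁿ (n ≥ 1) and K = conv{P₀, …, Pₙ} the n-simplex with volume |K| > 0 (Lebesgue measure). Then every affine function f : ℝⁿ → ℝ satisfies max_{j=0,…,n} f(P_j)² ≤ ((n+1)²/|K|) · ∫_K f² dx. -/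
open MeasureTheory

section SimplexHelpers

set_option linter.unusedSectionVars false
set_option linter.unusedSimpArgs false

variable {E : Type*} [NormedAddCommGroup E] [NormedSpace ℝ E] [FiniteDimensional ℝ E]
  [MeasurableSpace E] [BorelSpace E]

/-- Change of variables along `x ↦ x + l(x) v` with `l` affine. -/
theorem setIntegral_shear_image (μ : Measure E) [μ.IsAddHaarMeasure]
    (l : E →ᵃ[ℝ] ℝ) (v : E) (hd : 1 + l.linear v ≠ 0)
    (s : Set E) (hs : MeasurableSet s) (g : E → ℝ) :
    ∫ x in (fun x => x + l x • v) '' s, g x ∂μ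
      = |1 + l.linear v| * ∫ x in s, g (x + l x • v) ∂μ := by
  have hder : ∀ x, HasFDerivAt (fun x => x + l x • v)
      (LinearMap.toContinuousLinearMap (LinearMap.transvection l.linear v)) x := by
    intro x
    have h1 : HasFDerivAt (fun x : E => l x) (LinearMap.toContinuousLinearMap l.linear) x := by
      have h := (LinearMap.toContinuousLinearMap l.linear).hasFDerivAt (x := x)
      have h2 := h.add_const (l 0)
      refine h2.congr_of_eventuallyEq (Filter.Eventually.of_forall fun y => ?_)
      have := l.map_vadd 0 y
      simpa using this
    have h3 := (hasFDerivAt_id x).add (h1.smul_const v)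
    refine h3.congr_fderiv ?_
    ext y
    simp [LinearMap.transvection.apply]
  have hinj : Function.Injective (fun x => x + l x • v) := by
    intro x y hxy
    have hxy' : x + l x • v = y + l y • v := hxy
    have hl : ∀ z c, l (z + c • v) = l z + c * l.linear v := by
      intro z c
      have := l.map_vadd z (c • v)
      simp only [vadd_eq_add, map_smul, smul_eq_mul] at this
      rw [add_comm z, this, add_comm]
    have h1 := congrArg l hxy'
    rw [hl, hl] at h1
    have h2 : (l x - l y) * (1 + l.linear v) = 0 := by linarith
    have h3 : l x = l y := by
      rcases mul_eq_zero.1 h2 with h | h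
      · linarith
      · exact absurd h hd
    rw [h3] at hxy'
    exact add_right_cancel hxy'
  rw [integral_image_eq_integral_abs_det_fderiv_smul μ hs
    (fun x _ => (hder x).hasFDerivWithinAt) hinj.injOn g]
  have hdet : (LinearMap.toContinuousLinearMap (LinearMap.transvection l.linear v)).det
      = 1 + l.linear v := by
    rw [ContinuousLinearMap.det, LinearMap.coe_toContinuousLinearMap, LinearMap.transvection.det]
  simp only [hdet, smul_eq_mul]
  rw [integral_const_mul]

variable {n : ℕ} (b : AffineBasis (Fin (n + 1)) ℝ E)

theorem coord_lin (i k j : Fin (n + 1)) :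
    (b.coord k).linear (b i - b j) = (if k = i then 1 else 0) - (if k = j then 1 else 0) := by
  have := (b.coord k).linearMap_vsub (b i) (b j)
  simp only [vsub_eq_sub] at this
  rw [this, b.coord_apply, b.coord_apply]

theorem coord_add (x : E) (c : ℝ) (i k j : Fin (n + 1)) :
    b.coord k (x + c • (b i - b j))
      = b.coord k x + c * ((if k = i then 1 else 0) - (if k = j then 1 else 0)) := by
  have := (b.coord k).map_vadd x (c • (b i - b j))
  simp only [vadd_eq_add, map_smul, smul_eq_mul, coord_lin] at this
  rw [add_comm x, this, add_comm]

theorem simplex_isCompact : IsCompact {x | ∀ i, 0 ≤ b.coord i x} := by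
  rw [← b.convexHull_eq_nonneg_coord]
  exact (Set.finite_range b).isCompact_convexHull ℝ

theorem coord_continuous (i : Fin (n + 1)) : Continuous (b.coord i) :=
  (b.coord i).continuous_of_finiteDimensional

theorem simplex_diag_null (μ : Measure E) [μ.IsAddHaarMeasure] (i j : Fin (n + 1)) (hij : i ≠ j) :
    μ {x | b.coord i x = b.coord j x} = 0 := by
  let S : AffineSubspace ℝ E :=
    (AffineSubspace.mk' (0 : ℝ) ⊥).comap (b.coord i - b.coord j)
  have hmem : ∀ x, x ∈ S ↔ b.coord i x = b.coord j x := by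
    intro x
    simp [S, AffineSubspace.mem_comap, AffineSubspace.mem_mk', sub_eq_zero]
  have hS : S ≠ ⊤ := by
    intro h
    have h1 : b i ∈ S := by rw [h]; trivial
    rw [hmem, b.coord_apply_eq, b.coord_apply_ne hij.symm] at h1
    exact one_ne_zero h1
  have := Measure.addHaar_affineSubspace μ S hS
  convert this using 2
  ext x
  exact (hmem x).symm

/-- Bisecting an edge relates the second moments. -/
theorem moment_bisect (μ : Measure E) [μ.IsAddHaarMeasure] (i j : Fin (n + 1)) (hij : i ≠ j) :
    ∫ x in {x | ∀ i, 0 ≤ b.coord i x}, b.coord j x * b.coord j x ∂μ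
      = 2 * ∫ x in {x | ∀ i, 0 ≤ b.coord i x}, b.coord i x * b.coord j x ∂μ := by
  set K : Set E := {x | ∀ i, 0 ≤ b.coord i x} with hKdef
  have hKc : IsCompact K := simplex_isCompact b
  have hc := coord_continuous b
  set K0 : Set E := K ∩ {x | b.coord j x ≤ b.coord i x} with hK0
  set K1 : Set E := K ∩ {x | b.coord i x ≤ b.coord j x} with hK1
  have hK0c : IsCompact K0 := hKc.inter_right (isClosed_le (hc j) (hc i))
  have hK1c : IsCompact K1 := hKc.inter_right (isClosed_le (hc i) (hc j))
  have hji := hij.symm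
  have himg0 : (fun x => x + ((1 / 2 : ℝ) • b.coord j) x • (b i - b j)) '' K = K0 := by
    ext y
    constructor
    · rintro ⟨x, hx, rfl⟩
      refine ⟨fun k => ?_, ?_⟩
      · have h1 := hx k
        have h2 := hx j
        simp only [coord_add, AffineMap.coe_smul, Pi.smul_apply, smul_eq_mul]
        by_cases hki : k = i
        · subst hki; simp [hij]; positivity
        · by_cases hkj : k = j
          · subst hkj; simp [hji]; linarith
          · simp [hki, hkj, h1]
      · have h1 := hx i
        simp [coord_add, hij, hji]
        linarith
    · rintro ⟨hy, hy2⟩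
      have hy2' : b.coord j y ≤ b.coord i y := hy2
      refine ⟨y + (-b.coord j y) • (b i - b j), fun k => ?_, ?_⟩
      · have h1 := hy k
        have h2 := hy j
        simp only [coord_add]
        by_cases hki : k = i
        · subst hki; simp [hij]; linarith
        · by_cases hkj : k = j
          · subst hkj; simp [hji]; linarith
          · simp [hki, hkj, h1]
      · simp only [AffineMap.coe_smul, Pi.smul_apply, smul_eq_mul, coord_add]
        rw [add_assoc, ← add_smul]
        simp [hji]
        left; ring
  have himg1 : (fun x => x + (b.coord j - b.coord i) x • (b i - b j)) '' K0 = K1 := by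
    ext y
    constructor
    · rintro ⟨x, ⟨hx, hx2⟩, rfl⟩
      have hx2' : b.coord j x ≤ b.coord i x := hx2
      refine ⟨fun k => ?_, ?_⟩
      · have h1 := hx k
        have h2 := hx j
        have h3 := hx i
        simp only [coord_add, AffineMap.coe_sub, Pi.sub_apply]
        by_cases hki : k = i
        · subst hki; simp [hij]; linarith
        · by_cases hkj : k = j
          · subst hkj; simp [hji]; linarith
          · simp [hki, hkj, h1]
      · simp [coord_add, hij, hji]
        linarith
    · rintro ⟨hy, hy2⟩
      have hy2' : b.coord i y ≤ b.coord j y := hy2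
      refine ⟨y + (b.coord j y - b.coord i y) • (b i - b j), ⟨fun k => ?_, ?_⟩, ?_⟩
      · have h1 := hy k
        have h2 := hy j
        have h3 := hy i
        simp only [coord_add]
        by_cases hki : k = i
        · subst hki; simp [hij]; linarith
        · by_cases hkj : k = j
          · subst hkj; simp [hji]; linarith
          · simp [hki, hkj, h1]
      · simp [coord_add, hij, hji]
        linarith
      · simp only [AffineMap.coe_sub, Pi.sub_apply, coord_add]
        rw [add_assoc, ← add_smul]
        simp [hij, hji]
  have hint : ∀ p q, IntegrableOn (fun x => b.coord p x * b.coord q x) K μ := fun p q =>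
    ((hc p).mul (hc q)).continuousOn.integrableOn_compact hKc
  have hun : K = K0 ∪ K1 := by
    rw [hK0, hK1, ← Set.inter_union_distrib_left]
    ext x
    simp [le_total]
  have hdisj : AEDisjoint μ K0 K1 := by
    refine measure_mono_null ?_ (simplex_diag_null b μ i j hij)
    rintro x ⟨⟨_, h1⟩, ⟨_, h2⟩⟩
    exact le_antisymm h2 h1
  have e1 : ∫ x in K, b.coord i x * b.coord j x ∂μ
      = ∫ x in K0, b.coord i x * b.coord j x ∂μ + ∫ x in K1, b.coord i x * b.coord j x ∂μ := by
    conv_lhs => rw [hun]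
    exact setIntegral_union₀ hdisj hK1c.measurableSet.nullMeasurableSet
      ((hint i j).mono_set Set.inter_subset_left) ((hint i j).mono_set Set.inter_subset_left)
  have d1 : 1 + (b.coord j - b.coord i).linear (b i - b j) = -1 := by
    rw [AffineMap.sub_linear, LinearMap.sub_apply, coord_lin, coord_lin]
    simp only [hij, hji, if_true, if_false]; norm_num
  have d0 : 1 + ((1 / 2 : ℝ) • b.coord j).linear (b i - b j) = 1 / 2 := by
    rw [AffineMap.smul_linear, LinearMap.smul_apply, coord_lin]
    simp only [hji, if_true, if_false, smul_eq_mul]; norm_num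
  have e2 : ∫ x in K1, b.coord i x * b.coord j x ∂μ
      = ∫ x in K0, b.coord i x * b.coord j x ∂μ := by
    rw [← himg1, setIntegral_shear_image μ _ _ (by rw [d1]; norm_num) K0 hK0c.measurableSet, d1]
    simp only [coord_add, AffineMap.coe_sub, Pi.sub_apply]
    simp [hij, hji, mul_comm]
  have e3 : ∫ x in K0, b.coord i x * b.coord j x ∂μ
      = 1 / 2 * ((1 / 2) * ∫ x in K, b.coord i x * b.coord j x ∂μ +
        (1 / 4) * ∫ x in K, b.coord j x * b.coord j x ∂μ) := by
    rw [← himg0, setIntegral_shear_image μ _ _ (by rw [d0]; norm_num) K hKc.measurableSet, d0,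
      ← integral_const_mul (1 / 2 : ℝ) (fun x => b.coord i x * b.coord j x),
      ← integral_const_mul (1 / 4 : ℝ) (fun x => b.coord j x * b.coord j x),
      ← integral_add ((hint i j).const_mul _)
        ((hint j j).const_mul _), abs_of_pos (by norm_num)]
    congr 2
    ext x
    simp [coord_add, hij, hji]
    ring
  linarith

theorem affine_eq_sum (f : E →ᵃ[ℝ] ℝ) (x : E) : f x = ∑ i, f (b i) * b.coord i x := by
  have h := b.affineCombination_coord_eq_self x
  conv_lhs => rw [← h]
  rw [Finset.map_affineCombination _ _ _ (b.sum_coord_apply_eq_one x),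
    Finset.affineCombination_eq_linear_combination _ _ _ (b.sum_coord_apply_eq_one x)]
  simp [mul_comm]

/-- The algebraic minimisation. -/
theorem vertex_alg (a : Fin (n + 1) → ℝ) (j : Fin (n + 1)) :
    ((n : ℝ) + 2) * a j ^ 2 ≤ ((n : ℝ) + 1) * (∑ i, a i ^ 2 + (∑ i, a i) ^ 2) := by
  have hn : (0 : ℝ) < (n : ℝ) + 1 := by positivity
  obtain ⟨c, hcj⟩ : ∃ c, a j = ((n : ℝ) + 1) * c := ⟨a j / (n + 1), by field_simp⟩
  have h0 : 0 ≤ ∑ i ∈ Finset.univ.erase j, (a i + c) ^ 2 :=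
    Finset.sum_nonneg fun _ _ => sq_nonneg _
  have h1 := Finset.add_sum_erase Finset.univ (fun i => (a i + c) ^ 2) (Finset.mem_univ j)
  have h2 : ∑ i, (a i + c) ^ 2 = ∑ i, a i ^ 2 + 2 * c * ∑ i, a i + (n + 1) * c ^ 2 := by
    simp only [add_sq, Finset.sum_add_distrib, Finset.mul_sum]
    simp
    exact Finset.sum_congr rfl fun _ _ => by ring
  have h3 := sq_nonneg (∑ i, a i - c)
  set S := ∑ i, a i
  set Q := ∑ i, a i ^ 2
  rw [hcj] at h1 ⊢
  have h4 : ((n : ℝ) + 2) * ((n : ℝ) + 1) * c ^ 2 ≤ Q + S ^ 2 := by nlinarith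
  calc _ = ((n : ℝ) + 1) * (((n : ℝ) + 2) * ((n : ℝ) + 1) * c ^ 2) := by ring
    _ ≤ _ := mul_le_mul_of_nonneg_left h4 hn.le

theorem vertex_bound (μ : Measure E) [μ.IsAddHaarMeasure] (f : E →ᵃ[ℝ] ℝ) (j : Fin (n + 1)) :
    f (b j) ^ 2 * μ.real {x | ∀ i, 0 ≤ b.coord i x} ≤ ((n : ℝ) + 1) ^ 2 *
      ∫ x in {x | ∀ i, 0 ≤ b.coord i x}, f x ^ 2 ∂μ := by
  have hbis := moment_bisect b μ
  have hKc : IsCompact {x | ∀ i, 0 ≤ b.coord i x} := simplex_isCompact b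
  set K : Set E := {x | ∀ i, 0 ≤ b.coord i x} with hKdef
  have hc := coord_continuous b
  have hint : ∀ p q, IntegrableOn (fun x => b.coord p x * b.coord q x) K μ := fun p q =>
    ((hc p).mul (hc q)).continuousOn.integrableOn_compact hKc
  set A := ∫ x in K, b.coord j x * b.coord j x ∂μ with hA
  have hAnn : 0 ≤ A := integral_nonneg fun x => mul_self_nonneg _
  have hdiag : ∀ i, ∫ x in K, b.coord i x * b.coord i x ∂μ = A := by
    intro i
    by_cases h : i = j
    · rw [h]
    · have h1 := hbis i j h
      have h2 := hbis j i (Ne.symm h)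
      rw [hA, h1, h2]
      simp only [mul_comm]
  have hB : ∀ p q, ∫ x in K, b.coord p x * b.coord q x ∂μ
      = A / 2 + if p = q then A / 2 else 0 := by
    intro p q
    by_cases h : p = q
    · subst h; rw [hdiag]; simp
    · have h1 := hbis p q h
      rw [hdiag] at h1
      simp [h]; linarith
  -- integrals of squares
  have hsq : ∀ g : E →ᵃ[ℝ] ℝ, ∫ x in K, g x ^ 2 ∂μ
      = A / 2 * (∑ i, g (b i) ^ 2 + (∑ i, g (b i)) ^ 2) := by
    intro g
    have h1 : ∀ x, g x ^ 2 = ∑ p, ∑ q, (g (b p) * g (b q)) * (b.coord p x * b.coord q x) := by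
      intro x
      rw [affine_eq_sum b g x, sq, Finset.sum_mul_sum]
      exact Finset.sum_congr rfl fun _ _ => Finset.sum_congr rfl fun _ _ => by ring
    rw [funext h1]
    rw [integral_finsetSum _ fun p _ => integrable_finsetSum _ fun q _ => (hint p q).const_mul _]
    have h2 : ∀ p, ∫ x in K, ∑ q, (g (b p) * g (b q)) * (b.coord p x * b.coord q x) ∂μ
        = ∑ q, (g (b p) * g (b q)) * (A / 2 + if p = q then A / 2 else 0) := by
      intro p
      rw [integral_finsetSum _ fun q _ => (hint p q).const_mul _]
      refine Finset.sum_congr rfl fun q _ => ?_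
      rw [integral_const_mul, hB]
    simp only [h2, mul_add, Finset.sum_add_distrib]
    simp only [mul_ite, mul_zero, Finset.sum_ite_eq, Finset.mem_univ, if_true]
    rw [sq (∑ i, g (b i)), Finset.sum_mul_sum]
    simp only [Finset.mul_sum]
    rw [add_comm]
    congr 1
    · exact Finset.sum_congr rfl fun _ _ => by ring
    · exact Finset.sum_congr rfl fun _ _ => Finset.sum_congr rfl fun _ _ => by ring
  have hvol : μ.real K = A / 2 * (((n : ℝ) + 1) * ((n : ℝ) + 2)) := by
    have := hsq (AffineMap.const ℝ E 1)
    simp at this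
    rw [this]; ring
  rw [hvol, hsq]
  have := vertex_alg (fun i => f (b i)) j
  have h2 := mul_le_mul_of_nonneg_left this (show 0 ≤ A / 2 * ((n : ℝ) + 1) by positivity)
  linarith

end SimplexHelpers



/-- Appendix D, third estimate: for an `n`-simplex `K = conv{P₀, …, Pₙ}` and any
affine function `f`, `max_j f(P_j)² ≤ ((n+1)²/|K|) ∫_K f² dx`. -/
theorem max_vertex_value_sq_le (n : ℕ) (hn : 1 ≤ n)
    (P : Fin (n + 1) → EuclideanSpace ℝ (Fin n)) (hP : AffineIndependent ℝ P)
    (hK : 0 < (volume (convexHull ℝ (Set.range P))).toReal)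
    (f : EuclideanSpace ℝ (Fin n) →ᵃ[ℝ] ℝ) :
    Finset.univ.sup' Finset.univ_nonempty (fun j : Fin (n + 1) => (f (P j)) ^ 2) ≤
      ((n : ℝ) + 1) ^ 2 / (volume (convexHull ℝ (Set.range P))).toReal *
        ∫ x in convexHull ℝ (Set.range P), (f x) ^ 2 := by
  have htop : affineSpan ℝ (Set.range P) = ⊤ := by
    rw [hP.affineSpan_eq_top_iff_card_eq_finrank_add_one]
    simp
  let b : AffineBasis (Fin (n + 1)) ℝ (EuclideanSpace ℝ (Fin n)) := ⟨P, hP, htop⟩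
  have hbP : ∀ j, b j = P j := fun _ => rfl
  have hKeq : convexHull ℝ (Set.range P) = {x | ∀ i, 0 ≤ b.coord i x} :=
    b.convexHull_eq_nonneg_coord
  refine Finset.sup'_le _ _ fun j _ => ?_
  have h := vertex_bound b volume f j
  rw [← hKeq, hbP] at h
  rw [div_mul_eq_mul_div, le_div_iff₀ hK]
  exact h
end

section
/- Let 0 < ω₀ ≤ π/3 and let α, β, γ be real numbers with α + β + γ = π and ω₀ ≤ α, ω₀ ≤ β, ω₀ ≤ γ. Then cot α + cot β + cot γ ≤ 2 cot ω₀ − cot(2ω₀). -/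
lemma aux_max (c x y z : ℝ) (hc : 0 < c) (hx : 0 < x) (hxc : x ≤ c) (hy : y ≤ x) (hz : z ≤ x)
    (hyz : 0 < y + z) (h : x * y + y * z + z * x = 1) : x + y + z ≤ (3 * c ^ 2 + 1) / (2 * c) := by
  have h1 : 1 ≤ 3 * x ^ 2 := by
    nlinarith [sq_nonneg (y - z), mul_nonneg hyz.le (by linarith : 0 ≤ 2 * x - (y + z)),
      mul_nonneg hx.le (sub_nonneg.2 hy), mul_nonneg hx.le (sub_nonneg.2 hz)]
  have h2 : x + y + z ≤ (3 * x ^ 2 + 1) / (2 * x) := by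
    rw [le_div_iff₀ (by positivity)]
    nlinarith [mul_nonneg (sub_nonneg.2 hy) (sub_nonneg.2 hz)]
  refine h2.trans ?_
  rw [div_le_div_iff₀ (by positivity) (by positivity)]
  have h3 : 0 ≤ 3 * c * x - 1 := by nlinarith
  nlinarith [mul_nonneg (sub_nonneg.2 hxc) h3]

lemma aux_alg (c x y z : ℝ) (hc : 0 < c) (hx : x ≤ c) (hy : y ≤ c) (hz : z ≤ c)
    (h1 : 0 < x + y) (h2 : 0 < y + z) (h3 : 0 < z + x)
    (h : x * y + y * z + z * x = 1) : x + y + z ≤ (3 * c ^ 2 + 1) / (2 * c) := by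
  rcases le_total x y with a | a <;> rcases le_total y z with b | b <;>
    rcases le_total x z with d | d
  all_goals first
    | exact aux_max c x y z hc (by linarith) hx (by linarith) (by linarith) h2 h
    | (have := aux_max c y z x hc (by linarith) hy (by linarith) (by linarith) (by linarith) (by linarith)
       linarith)
    | (have := aux_max c z x y hc (by linarith) hz (by linarith) (by linarith) (by linarith) (by linarith)
       linarith)

lemma aux_add (a b : ℝ) (ha : 0 < a) (hb : 0 < b) (hab : a + b < Real.pi) :
    0 < Real.cot a + Real.cot b := by
  have sa := Real.sin_pos_of_pos_of_lt_pi ha (by linarith)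
  have sb := Real.sin_pos_of_pos_of_lt_pi hb (by linarith)
  have sab := Real.sin_pos_of_pos_of_lt_pi (by linarith) hab
  rw [Real.sin_add] at sab
  rw [Real.cot_eq_cos_div_sin, Real.cot_eq_cos_div_sin, div_add_div _ _ sa.ne' sb.ne']
  apply div_pos _ (by positivity)
  linarith

lemma aux_anti (a b : ℝ) (ha : 0 < a) (hab : a ≤ b) (hb : b < Real.pi) :
    Real.cot b ≤ Real.cot a := by
  have sa := Real.sin_pos_of_pos_of_lt_pi ha (by linarith)
  have sb := Real.sin_pos_of_pos_of_lt_pi (by linarith) hb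
  have sab := Real.sin_nonneg_of_nonneg_of_le_pi (x := b - a) (by linarith) (by linarith)
  rw [Real.sin_sub] at sab
  rw [Real.cot_eq_cos_div_sin, Real.cot_eq_cos_div_sin, div_le_div_iff₀ sb sa]
  linarith

/-- The maximisation used in Section 6.3: if the interior angles `α, β, γ` of a
triangle (summing to `π`) are all at least `ω₀ ∈ (0, π/3]`, then
`cot α + cot β + cot γ ≤ 2 cot ω₀ - cot(2ω₀)`. -/
theorem cot_sum_le_of_min_angle (ω₀ α β γ : ℝ) (h0 : 0 < ω₀) (h3 : ω₀ ≤ Real.pi / 3)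
    (hsum : α + β + γ = Real.pi) (hα : ω₀ ≤ α) (hβ : ω₀ ≤ β) (hγ : ω₀ ≤ γ) :
    Real.cot α + Real.cot β + Real.cot γ ≤ 2 * Real.cot ω₀ - Real.cot (2 * ω₀) := by
  have sw := Real.sin_pos_of_pos_of_lt_pi h0 (by linarith)
  have cw : 0 < Real.cos ω₀ := Real.cos_pos_of_mem_Ioo ⟨by linarith, by linarith⟩
  have hR : 2 * Real.cot ω₀ - Real.cot (2 * ω₀)
      = (3 * Real.cot ω₀ ^ 2 + 1) / (2 * Real.cot ω₀) := by
    simp only [Real.cot_eq_cos_div_sin]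
    rw [Real.sin_two_mul, Real.cos_two_mul']
    field_simp
    ring
  have hc : 0 < Real.cot ω₀ := by
    rw [Real.cot_eq_cos_div_sin]; positivity
  rw [hR]
  refine aux_alg _ _ _ _ hc (aux_anti _ _ h0 hα (by linarith)) (aux_anti _ _ h0 hβ (by linarith))
    (aux_anti _ _ h0 hγ (by linarith)) (aux_add _ _ (by linarith) (by linarith) (by linarith))
    (aux_add _ _ (by linarith) (by linarith) (by linarith))
    (aux_add _ _ (by linarith) (by linarith) (by linarith)) ?_
  have sa := Real.sin_pos_of_pos_of_lt_pi (x := α) (by linarith) (by linarith)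
  have sb := Real.sin_pos_of_pos_of_lt_pi (x := β) (by linarith) (by linarith)
  have sc := Real.sin_pos_of_pos_of_lt_pi (x := γ) (by linarith) (by linarith)
  have hg : γ = Real.pi - (α + β) := by linarith
  have e1 : Real.sin γ = Real.sin α * Real.cos β + Real.cos α * Real.sin β := by
    rw [hg, Real.sin_pi_sub, Real.sin_add]
  have e2 : Real.cos γ = Real.sin α * Real.sin β - Real.cos α * Real.cos β := by
    rw [hg, Real.cos_pi_sub, Real.cos_add]; ring
  simp only [Real.cot_eq_cos_div_sin]
  field_simp
  rw [e1, e2]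
  ring
end

section
/- Let A, B, C be three affinely independent points in ℝ² forming a triangle T = conv{A, B, C} with area |T| (Lebesgue measure), diameter h_T = max{dist(A,B), dist(B,C), dist(C,A)}, and minimal interior angle at least ω₀ with 0 < ω₀ ≤ π/3 (i.e. each of the angles ∠BAC, ∠ABC, ∠BCA is at least ω₀). Then h_T² ≤ 4 |T| cot(ω₀). -/
open MeasureTheory EuclideanGeometry

lemma aux_tri_vol :
    volume {p : Fin 2 → ℝ | 0 < p 0 ∧ p 0 < 1 ∧ 0 < p 1 ∧ p 1 < 1 - p 0} = ENNReal.ofReal (1/2) := by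
  have h1 : {p : Fin 2 → ℝ | 0 < p 0 ∧ p 0 < 1 ∧ 0 < p 1 ∧ p 1 < 1 - p 0}
      = MeasurableEquiv.finTwoArrow ⁻¹'
        (regionBetween (fun _ : ℝ => (0:ℝ)) (fun x => 1 - x) (Set.Ioo 0 1)) := by
    ext p
    simp [regionBetween, and_assoc]
  have hm : MeasurableSet (regionBetween (fun _ : ℝ => (0:ℝ)) (fun x => 1 - x) (Set.Ioo 0 1)) :=
    measurableSet_regionBetween measurable_const (by fun_prop) measurableSet_Ioo
  rw [h1, (volume_preserving_finTwoArrow ℝ).measure_preimage hm.nullMeasurableSet]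
  rw [Measure.volume_eq_prod, volume_regionBetween_eq_integral]
  · congr 1
    rw [← integral_Ioc_eq_integral_Ioo, ← intervalIntegral.integral_of_le zero_le_one]
    simp only [Pi.sub_apply, sub_zero]
    rw [intervalIntegral.integral_sub (by simp) (by simp), integral_id]
    norm_num
  · exact integrableOn_const (by simp)
  · exact ((continuous_const.sub continuous_id).continuousOn.integrableOn_Icc (a := (0:ℝ)) (b := 1)).mono_set Set.Ioo_subset_Icc_self
  · exact measurableSet_Ioo
  · intro x hx; simp; exact hx.2.le

/-- Twice the unsigned area of the parallelogram spanned by `u` and `v`. -/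
noncomputable def auxD (u v : EuclideanSpace ℝ (Fin 2)) : ℝ := |u 0 * v 1 - v 0 * u 1|

lemma aux_area (A B C : EuclideanSpace ℝ (Fin 2)) :
    auxD (B - A) (C - A) / 2 ≤ (volume (convexHull ℝ {A, B, C})).toReal := by
  have hcomp : IsCompact (convexHull ℝ {A, B, C}) :=
    (Set.toFinite ({A, B, C} : Set (EuclideanSpace ℝ (Fin 2)))).isCompact_convexHull ℝ
  set K := convexHull ℝ {A, B, C} with hK
  rw [← ENNReal.ofReal_le_iff_le_toReal hcomp.measure_lt_top.ne]
  rw [← (PiLp.volume_preserving_toLp (Fin 2)).measure_preimage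
    hcomp.measurableSet.nullMeasurableSet]
  set M : Matrix (Fin 2) (Fin 2) ℝ := !![(B - A) 0, (C - A) 0; (B - A) 1, (C - A) 1] with hM
  set S := {p : Fin 2 → ℝ | 0 < p 0 ∧ p 0 < 1 ∧ 0 < p 1 ∧ p 1 < 1 - p 0} with hS
  have hv : volume ((fun x => WithLp.ofLp A + x) '' (Matrix.toLin' M '' S)) =
      ENNReal.ofReal (auxD (B - A) (C - A) / 2) := by
    rw [Set.image_add_left, measure_preimage_add, Measure.addHaar_image_linearMap,
      LinearMap.det_toLin', aux_tri_vol, ← ENNReal.ofReal_mul (abs_nonneg _)]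
    congr 1
    rw [hM, Matrix.det_fin_two_of, auxD]
    ring
  rw [← hv]
  apply measure_mono
  rintro _ ⟨_, ⟨p, hp, rfl⟩, rfl⟩
  obtain ⟨h1, h2, h3, h4⟩ := hp
  have hA : A ∈ K := subset_convexHull _ _ (by simp)
  have hB : B ∈ K := subset_convexHull _ _ (by simp)
  have hC : C ∈ K := subset_convexHull _ _ (by simp)
  have hc : Convex ℝ K := convex_convexHull _ _
  have key := hc.sum_mem (t := Finset.univ) (w := ![1 - p 0 - p 1, p 0, p 1]) (z := ![A, B, C])
    (by intro i _; fin_cases i <;> simp <;> linarith)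
    (by simp [Fin.sum_univ_three]; ring)
    (by intro i _; fin_cases i <;> simp <;> assumption)
  simp only [Set.mem_preimage]
  convert key using 1
  ext i
  fin_cases i <;> simp [Fin.sum_univ_three, hM, Matrix.mulVec, dotProduct, Fin.sum_univ_two] <;> ring

lemma aux_inner (u v : EuclideanSpace ℝ (Fin 2)) (w : ℝ) (h0 : 0 < w) (h3 : w ≤ Real.pi / 3)
    (h : w ≤ InnerProductGeometry.angle u v) : inner ℝ u v ≤ auxD u v * Real.cot w := by
  have hpi := Real.pi_pos
  have hs : 0 < Real.sin w := Real.sin_pos_of_pos_of_lt_pi h0 (by linarith)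
  have e1 := InnerProductGeometry.sin_angle_mul_norm_mul_norm u v
  have e2 := InnerProductGeometry.cos_angle_mul_norm_mul_norm u v
  have e3 : √(inner ℝ u u * inner ℝ v v - inner ℝ u v * inner ℝ u v) = auxD u v := by
    rw [auxD, ← Real.sqrt_sq_eq_abs]
    congr 1
    simp only [PiLp.inner_apply, Fin.sum_univ_two, RCLike.inner_apply, conj_trivial, PiLp.sub_apply]
    ring
  rw [e3] at e1
  have e4 : 0 ≤ Real.sin (InnerProductGeometry.angle u v - w) :=
    Real.sin_nonneg_of_nonneg_of_le_pi (by linarith)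
      (by linarith [InnerProductGeometry.angle_le_pi u v])
  rw [Real.sin_sub] at e4
  have e5 := mul_nonneg e4 (mul_nonneg (norm_nonneg u) (norm_nonneg v))
  rw [Real.cot_eq_cos_div_sin, ← mul_div_assoc, le_div_iff₀ hs, ← e1, ← e2]
  linarith

lemma aux_side (A B : EuclideanSpace ℝ (Fin 2)) (C : EuclideanSpace ℝ (Fin 2)) (w : ℝ)
    (h0 : 0 < w) (h3 : w ≤ Real.pi / 3) (hA : w ≤ ∠ B A C) (hB : w ≤ ∠ A B C) :
    dist A B ^ 2 ≤ 2 * auxD (B - A) (C - A) * Real.cot w := by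
  have a := aux_inner (B - A) (C - A) w h0 h3 hA
  have b := aux_inner (A - B) (C - B) w h0 h3 hB
  have e : auxD (A - B) (C - B) = auxD (B - A) (C - A) := by
    rw [auxD, auxD, ← abs_neg]; congr 1; simp; ring
  have f : dist A B ^ 2 = inner ℝ (B - A) (C - A) + inner ℝ (A - B) (C - B) := by
    rw [dist_eq_norm, ← real_inner_self_eq_norm_sq]
    simp only [PiLp.inner_apply, Fin.sum_univ_two, RCLike.inner_apply, conj_trivial, PiLp.sub_apply]
    ring
  rw [e] at b
  linarith

/-- The geometric estimate `h_T² ≤ 4 |T| cot ω₀` of Section 6.3 for a triangle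
`T = conv{A, B, C}` with minimal interior angle at least `ω₀ ∈ (0, π/3]`. -/
theorem diam_sq_le_four_area_cot (A B C : EuclideanSpace ℝ (Fin 2))
    (h : AffineIndependent ℝ ![A, B, C]) (ω₀ : ℝ) (h0 : 0 < ω₀)
    (h3 : ω₀ ≤ Real.pi / 3)
    (hA : ω₀ ≤ ∠ B A C) (hB : ω₀ ≤ ∠ A B C) (hC : ω₀ ≤ ∠ B C A) :
    (max (dist A B) (max (dist B C) (dist C A))) ^ 2 ≤
      4 * (volume (convexHull ℝ {A, B, C})).toReal * Real.cot ω₀ := by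
  have hpi := Real.pi_pos
  have hcot : 0 ≤ Real.cot ω₀ := by
    rw [Real.cot_eq_cos_div_sin]
    exact div_nonneg (Real.cos_nonneg_of_neg_pi_div_two_le_of_le (by linarith) (by linarith))
      (Real.sin_nonneg_of_nonneg_of_le_pi h0.le (by linarith))
  have ar := mul_le_mul_of_nonneg_right (aux_area A B C) hcot
  have s1 := aux_side A B C ω₀ h0 h3 hA hB
  have s2 := aux_side B C A ω₀ h0 h3 (by rwa [EuclideanGeometry.angle_comm]) hC
  have s3 := aux_side C A B ω₀ h0 h3 (by rwa [EuclideanGeometry.angle_comm])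
    (by rwa [EuclideanGeometry.angle_comm])
  have e2 : auxD (C - B) (A - B) = auxD (B - A) (C - A) := by
    rw [auxD, auxD]; congr 1; simp; ring
  have e3 : auxD (A - C) (B - C) = auxD (B - A) (C - A) := by
    rw [auxD, auxD]; congr 1; simp; ring
  rw [e2] at s2
  rw [e3] at s3
  rcases max_choice (dist A B) (max (dist B C) (dist C A)) with m | m <;> rw [m]
  · linarith
  · rcases max_choice (dist B C) (dist C A) with m | m <;> rw [m] <;> linarith
end

section
/- Let P₀, P₁, …, Pₙ be n+1 affinely independent points in ℝⁿ (n ≥ 1), K = conv{P₀, …, Pₙ} the n-simplex with volume |K| > 0 (Lebesgue measure), φ₀, …, φₙ the barycentric coordinate functions of K, and for each k let F_k = conv{P_j : j ≠ k} be the side opposite P_k, equipped with (n−1)-dimensional Hausdorff measure. Define the normalized side-bubble functions b_k := (Π_{j ≠ k} φ_j) / (⨍_{F_k} Π_{j ≠ k} φ_j dH^{n−1}) for k = 0, …, n. Then for all j, k ∈ {0, …, n}: ∫_K b_j b_k dx = 2^{n−3} ((2n)!)² |K| (1 + δ_jk) / ((3n)! · n!). -/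
open MeasureTheory

/-- Beta integral with natural exponents. -/
lemma beta_nat (N : ℕ) : ∀ (a : ℕ) (s : ℝ), ∫ t in (0:ℝ)..s, t ^ a * (s - t) ^ N =
    s ^ (a + N + 1) * ((a.factorial : ℝ) * N.factorial / (a + N + 1).factorial) := by
  induction N with
  | zero =>
    intro a s
    simp [Nat.factorial_succ]
    have : (a.factorial : ℝ) ≠ 0 := by positivity
    field_simp
  | succ N ih =>
    intro a s
    have h := intervalIntegral.integral_mul_deriv_eq_deriv_mul (a := 0) (b := s)
      (u := fun t => (s - t) ^ (N + 1)) (v := fun t => t ^ (a + 1) / ((a : ℝ) + 1))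
      (u' := fun t => -(((N : ℝ) + 1) * (s - t) ^ N)) (v' := fun t => t ^ a)
      (fun t _ => by
        have := ((hasDerivAt_id t).const_sub s).pow (N + 1)
        convert this using 1
        · rfl
        · simp only [Nat.add_sub_cancel, id]
          push_cast
          ring)
      (fun t _ => by
        have := ((hasDerivAt_id t).pow (a + 1)).div_const ((a : ℝ) + 1)
        have h0 : (a : ℝ) + 1 ≠ 0 := by positivity
        convert this using 1
        · rfl
        · simp only [Nat.add_sub_cancel, id]
          push_cast
          field_simp)
      (Continuous.intervalIntegrable (by fun_prop) _ _)
      (Continuous.intervalIntegrable (by fun_prop) _ _)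
    have h1 : ∫ t in (0:ℝ)..s, t ^ a * (s - t) ^ (N + 1) =
        ∫ t in (0:ℝ)..s, (s - t) ^ (N + 1) * t ^ a := by
      congr 1; ext t; ring
    have h2 : ∫ t in (0:ℝ)..s, -(((N : ℝ) + 1) * (s - t) ^ N) * (t ^ (a + 1) / ((a : ℝ) + 1)) =
        -(((N : ℝ) + 1) / ((a : ℝ) + 1)) * ∫ t in (0:ℝ)..s, t ^ (a + 1) * (s - t) ^ N := by
      rw [← intervalIntegral.integral_const_mul]
      congr 1; ext t; ring
    rw [h1, h, h2, ih]
    have e : a + 1 + N + 1 = a + (N + 1) + 1 := by ring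
    have h0 : (a : ℝ) + 1 ≠ 0 := by positivity
    rw [e, Nat.factorial_succ a, Nat.factorial_succ N]
    simp
    field_simp

/-- The standard solid simplex of size `s`. -/
def solidT (m : ℕ) (s : ℝ) : Set (Fin m → ℝ) := {x | (∀ i, 0 ≤ x i) ∧ ∑ i, x i ≤ s}

lemma solidT_isClosed (m : ℕ) (s : ℝ) : IsClosed (solidT m s) := by
  have : solidT m s = (⋂ i, {x : Fin m → ℝ | 0 ≤ x i}) ∩ {x | ∑ i, x i ≤ s} := by
    ext x; simp [solidT]
  rw [this]
  exact (isClosed_iInter fun i => isClosed_le (by fun_prop) (by fun_prop)).inter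
    (isClosed_le (by fun_prop) (by fun_prop))

lemma solidT_isCompact (m : ℕ) (s : ℝ) : IsCompact (solidT m s) := by
  refine (isCompact_Icc (a := (0 : Fin m → ℝ)) (b := fun _ => s)).of_isClosed_subset
    (solidT_isClosed m s) ?_
  rintro x ⟨h0, h1⟩
  refine ⟨fun i => h0 i, fun i => ?_⟩
  exact (Finset.single_le_sum (fun i _ => h0 i) (Finset.mem_univ i)).trans h1

lemma dirichlet (m : ℕ) : ∀ (α : Fin m → ℕ) (β : ℕ) (s : ℝ), 0 ≤ s →
    ∫ x in solidT m s, (∏ i, x i ^ α i) * (s - ∑ i, x i) ^ β =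
      s ^ (m + ∑ i, α i + β) *
        ((∏ i, ((α i).factorial : ℝ)) * β.factorial / (m + ∑ i, α i + β).factorial) := by
  induction m with
  | zero =>
    intro α β s hs
    have : solidT 0 s = Set.univ := by ext x; simp [solidT, hs]
    rw [this]
    have : (β.factorial : ℝ) ≠ 0 := by positivity
    simp [this, Measure.real, volume_pi]
  | succ m ih =>
    intro α β s hs
    set g : (Fin (m + 1) → ℝ) → ℝ := fun x => (∏ i, x i ^ α i) * (s - ∑ i, x i) ^ β with hg
    have hgc : Continuous g := by fun_prop
    have hm := (solidT_isClosed (m + 1) s).measurableSet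
    have hint : Integrable ((solidT (m + 1) s).indicator g) :=
      (integrable_indicator_iff hm).2 (hgc.continuousOn.integrableOn_compact (solidT_isCompact _ _))
    have mp := (volume_preserving_piFinSuccAbove (fun _ : Fin (m + 1) => ℝ) 0).symm
    rw [← integral_indicator hm, ← mp.integral_comp' , Measure.volume_eq_prod, integral_prod]
    swap
    · exact (mp.integrable_comp_emb (MeasurableEquiv.measurableEmbedding _)).2 hint
    have key : ∀ t : ℝ, (∫ y : Fin m → ℝ, (solidT (m + 1) s).indicator g
        ((MeasurableEquiv.piFinSuccAbove (fun _ : Fin (m + 1) => ℝ) 0).symm (t, y))) =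
        (Set.Icc 0 s).indicator (fun t => t ^ α 0 * (s - t) ^ (m + ∑ i : Fin m, α i.succ + β) *
          ((∏ i : Fin m, ((α i.succ).factorial : ℝ)) * β.factorial /
            (m + ∑ i : Fin m, α i.succ + β).factorial)) t := by
      intro t
      have e : ∀ y : Fin m → ℝ, (MeasurableEquiv.piFinSuccAbove (fun _ : Fin (m + 1) => ℝ) 0).symm
          (t, y) = Fin.cons t y := by
        intro y
        simp [MeasurableEquiv.piFinSuccAbove, Fin.insertNthEquiv]
      simp only [e]
      by_cases ht : t ∈ Set.Icc 0 s
      · rw [Set.indicator_of_mem ht, mul_assoc, ← ih _ _ _ (sub_nonneg.2 ht.2),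
          ← integral_const_mul, ← integral_indicator (solidT_isClosed m _).measurableSet]
        congr 1; ext y
        have hiff : (Fin.cons t y : Fin (m + 1) → ℝ) ∈ solidT (m + 1) s ↔ y ∈ solidT m (s - t) := by
          simp only [solidT, Set.mem_ofPred_eq, Fin.forall_fin_succ, Fin.sum_univ_succ, Fin.cons_zero,
            Fin.cons_succ]
          constructor
          · rintro ⟨⟨_, h⟩, h'⟩; exact ⟨h, by linarith⟩
          · rintro ⟨h, h'⟩; exact ⟨⟨ht.1, h⟩, by linarith⟩
        by_cases hy : y ∈ solidT m (s - t)
        · rw [Set.indicator_of_mem hy, Set.indicator_of_mem (hiff.2 hy)]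
          simp only [hg, Fin.prod_univ_succ, Fin.sum_univ_succ, Fin.cons_zero, Fin.cons_succ]
          rw [← sub_sub]; ring
        · rw [Set.indicator_of_notMem hy, Set.indicator_of_notMem (mt hiff.1 hy)]
      · rw [Set.indicator_of_notMem ht]
        have : ∀ y : Fin m → ℝ, (Fin.cons t y : Fin (m + 1) → ℝ) ∉ solidT (m + 1) s := by
          intro y
          simp only [solidT, Set.mem_ofPred_eq, Fin.forall_fin_succ, Fin.sum_univ_succ, Fin.cons_zero,
            Fin.cons_succ]
          rintro ⟨⟨h0, h⟩, h'⟩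
          have := Finset.sum_nonneg (fun i (_ : i ∈ Finset.univ) => h i)
          exact ht ⟨h0, by linarith⟩
        simp [this]
    refine (integral_congr_ae (ae_of_all _ key)).trans ?_
    rw [integral_indicator measurableSet_Icc, integral_Icc_eq_integral_Ioc,
      ← intervalIntegral.integral_of_le hs, intervalIntegral.integral_mul_const, beta_nat]
    have e : α 0 + (m + ∑ i : Fin m, α i.succ + β) + 1 = m + 1 + ∑ i, α i + β := by
      rw [Fin.sum_univ_succ]; ring
    rw [e, Fin.prod_univ_succ]
    field_simp

/-- Measure proportionality for linear embeddings. -/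
lemma comap_haar {E : Type*} [NormedAddCommGroup E] [NormedSpace ℝ E]
    [MeasurableSpace E] [BorelSpace E] (m : ℕ) (p : E) (L : (Fin m → ℝ) →ₗ[ℝ] E)
    (hL : Function.Injective L) :
    ∃ c : NNReal, 0 < c ∧ MeasurableEmbedding (fun x => p + L x) ∧
      (μH[(m : ℝ)] : Measure E).comap (fun x => p + L x) = c • volume := by
  have hker : LinearMap.ker L = ⊥ := LinearMap.ker_eq_bot.2 hL
  obtain ⟨K, hK0, hK⟩ := L.exists_antilipschitzWith hker
  have hlip := L.toContinuousLinearMap.lipschitz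
  set A : (Fin m → ℝ) → E := fun x => p + L x with hA
  have hKA : AntilipschitzWith K A := by
    intro x y; simpa [hA, edist_add_left] using hK x y
  have hLA : LipschitzWith ‖L.toContinuousLinearMap‖₊ A := by
    intro x y; simpa [hA, edist_add_left] using hlip x y
  have hcl : Topology.IsClosedEmbedding A := hKA.isClosedEmbedding hLA.uniformContinuous
  have hme := hcl.measurableEmbedding
  have hv : (μH[(m : ℝ)] : Measure (Fin m → ℝ)) = volume := by
    simpa using hausdorffMeasure_pi_real (ι := Fin m)
  have happ : ∀ S, (μH[(m : ℝ)] : Measure E).comap A S = μH[(m : ℝ)] (A '' S) :=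
    fun S => hme.comap_apply _ _
  have hm0 : (0 : ℝ) ≤ m := by positivity
  have : Measure.IsAddHaarMeasure ((μH[(m : ℝ)] : Measure E).comap A) :=
    { lt_top_of_isCompact := by
        intro S hS
        rw [happ]
        refine (hLA.hausdorffMeasure_image_le hm0 S).trans_lt ?_
        rw [hv]
        exact ENNReal.mul_lt_top (ENNReal.rpow_lt_top_of_nonneg hm0 ENNReal.coe_ne_top)
          hS.measure_lt_top
      map_add_left_eq_self := by
        intro v
        ext S hS
        rw [Measure.map_apply (measurable_const_add v) hS, happ, happ]
        have : A '' S = (fun y => L v + y) '' (A '' ((fun x => v + x) ⁻¹' S)) := by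
          ext y
          simp only [Set.mem_image, Set.mem_preimage, exists_exists_and_eq_and]
          constructor
          · rintro ⟨x, hx, rfl⟩
            exact ⟨x - v, by simpa using hx, by simp [hA]; abel⟩
          · rintro ⟨x, hx, rfl⟩
            exact ⟨v + x, hx, by simp [hA]; abel⟩
        rw [this]
        exact ((isometry_add_left (L v)).hausdorffMeasure_image (Or.inl hm0) _).symm
      open_pos := by
        intro U hU hne h0
        rw [happ] at h0
        have := hKA.le_hausdorffMeasure_image hm0 U
        rw [h0, mul_zero, hv] at this
        exact (hU.measure_pos volume hne).not_ge this }
  refine ⟨_, ?_, hme, Measure.isAddLeftInvariant_eq_smul _ volume⟩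
  exact Measure.addHaarScalarFactor_pos_of_isAddHaarMeasure _ _

lemma simplex_param {E : Type*} [NormedAddCommGroup E] [NormedSpace ℝ E] (m : ℕ)
    (P : Fin (m + 1) → E) (L : (Fin m → ℝ) →ₗ[ℝ] E)
    (hL : ∀ x, L x = ∑ i, x i • (P i.succ - P 0)) :
    (fun x => P 0 + L x) '' solidT m 1 = convexHull ℝ (Set.range P) := by
  apply Set.Subset.antisymm
  · rintro _ ⟨x, ⟨h0, h1⟩, rfl⟩
    have : P 0 + L x = ∑ j, (Fin.cons (1 - ∑ i, x i) x : Fin (m + 1) → ℝ) j • P j := by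
      simp only [Fin.sum_univ_succ, Fin.cons_zero, Fin.cons_succ, hL, smul_sub,
        Finset.sum_sub_distrib, sub_smul, Finset.sum_smul, one_smul]
      abel
    show P 0 + L x ∈ _
    rw [this]
    refine (convex_convexHull ℝ _).sum_mem ?_ ?_ ?_
    · intro j _
      refine Fin.cases ?_ (fun i => ?_) j
      · simpa using h1
      · simpa using h0 i
    · simp [Fin.sum_univ_succ]
    · intro j _; exact subset_convexHull ℝ _ ⟨j, rfl⟩
  · apply convexHull_min
    · rintro _ ⟨j, rfl⟩
      refine Fin.cases ?_ (fun i => ?_) j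
      · exact ⟨0, by simp [solidT], by simp⟩
      · refine ⟨Pi.single i 1, ⟨fun k => ?_, by simp⟩, ?_⟩
        · by_cases h : k = i
          · subst h; simp
          · simp [h]
        · simp [hL, Pi.single_apply]
    · have hc : Convex ℝ (solidT m 1) := by
        rintro x ⟨hx0, hx1⟩ y ⟨hy0, hy1⟩ a b ha hb hab
        refine ⟨fun i => ?_, ?_⟩
        · have := hx0 i; have := hy0 i
          simp only [Pi.add_apply, Pi.smul_apply, smul_eq_mul]; positivity
        · simp only [Pi.add_apply, Pi.smul_apply, smul_eq_mul, Finset.sum_add_distrib,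
            ← Finset.mul_sum]
          nlinarith
      have := (hc.linear_image L).translate (P 0)
      rwa [Set.image_image] at this

lemma simplex_integral {E : Type*} [NormedAddCommGroup E] [NormedSpace ℝ E]
    [MeasurableSpace E] [BorelSpace E] (m : ℕ)
    (P : Fin (m + 1) → E) (φ : Fin (m + 1) → E →ᵃ[ℝ] ℝ)
    (hφ : ∀ j k, φ j (P k) = if j = k then 1 else 0) (α : Fin (m + 1) → ℕ) :
    0 < (μH[(m : ℝ)] (convexHull ℝ (Set.range P))).toReal ∧
    ∫ y in convexHull ℝ (Set.range P), ∏ j, φ j y ^ α j ∂(μH[(m : ℝ)]) =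
      (μH[(m : ℝ)] (convexHull ℝ (Set.range P))).toReal *
        ((m.factorial : ℝ) * (∏ j, ((α j).factorial : ℝ)) / (m + ∑ j, α j).factorial) := by
  set L : (Fin m → ℝ) →ₗ[ℝ] E := Fintype.linearCombination ℝ (fun i : Fin m => P i.succ - P 0)
    with hLdef
  have hL : ∀ x, L x = ∑ i, x i • (P i.succ - P 0) := fun x => by
    simp [hLdef, Fintype.linearCombination_apply]
  have hφL : ∀ j x, φ j (P 0 + L x) = (Fin.cons (1 - ∑ i, x i) x : Fin (m + 1) → ℝ) j := by
    intro j x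
    have h1 : φ j (P 0 + L x) = (φ j).linear (L x) + φ j (P 0) := by
      rw [add_comm, ← vadd_eq_add, AffineMap.map_vadd, vadd_eq_add]
    have h2 : ∀ i : Fin m, (φ j).linear (P i.succ - P 0) = φ j (P i.succ) - φ j (P 0) := by
      intro i
      rw [← vsub_eq_sub, AffineMap.linearMap_vsub, vsub_eq_sub]
    rw [h1, hL, map_sum]
    simp only [map_smul, h2, hφ, smul_eq_mul]
    refine Fin.cases ?_ (fun i => ?_) j
    · simp [Fin.ext_iff]; ring
    · simp
  have hinj : Function.Injective L := by
    intro x y h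
    ext i
    have := hφL i.succ x
    rw [h, hφL] at this
    simpa using this.symm
  obtain ⟨c, hc, hme, hcm⟩ := comap_haar m (P 0) L hinj
  have himg := simplex_param m P L hL
  have hvol : μH[(m : ℝ)] (convexHull ℝ (Set.range P)) = c * volume (solidT m 1) := by
    rw [← himg, ← hme.comap_apply, hcm]; rfl
  have hint : ∀ f : E → ℝ, ∫ y in convexHull ℝ (Set.range P), f y ∂(μH[(m : ℝ)]) =
      c * ∫ x in solidT m 1, f (P 0 + L x) := by
    intro f
    have h1 : ∫ x in solidT m 1, f (P 0 + L x) ∂((μH[(m : ℝ)] : Measure E).comap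
        (fun x => P 0 + L x)) = c * ∫ x in solidT m 1, f (P 0 + L x) := by
      rw [hcm, Measure.restrict_smul, integral_smul_nnreal_measure]; rfl
    have h2 := hme.setIntegral_map (μ := (μH[(m : ℝ)] : Measure E).comap (fun x => P 0 + L x))
      f ((fun x => P 0 + L x) '' solidT m 1)
    rw [hme.map_comap, Measure.restrict_restrict_of_subset (Set.image_subset_range _ _),
      Set.preimage_image_eq _ hme.injective, himg] at h2
    rw [← h1, h2]
  have hv1 : (volume (solidT m 1)).toReal = 1 / m.factorial := by
    have := dirichlet m (fun _ => 0) 0 1 zero_le_one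
    simpa [Measure.real] using this
  have hd := dirichlet m (fun i => α i.succ) (α 0) 1 zero_le_one
  have htr : (μH[(m : ℝ)] (convexHull ℝ (Set.range P))).toReal = c * (1 / m.factorial) := by
    rw [hvol, ENNReal.toReal_mul, hv1]; rfl
  refine ⟨by rw [htr]; positivity, ?_⟩
  rw [hint, htr]
  simp only [hφL, Fin.prod_univ_succ, Fin.cons_zero, Fin.cons_succ, Fin.sum_univ_succ]
  have : m + (α 0 + ∑ i : Fin m, α i.succ) = m + ∑ i : Fin m, α i.succ + α 0 := by ring
  rw [this]
  simp only [mul_comm ((1 - ∑ i, _ : ℝ) ^ _), hd]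
  have : (m.factorial : ℝ) ≠ 0 := by positivity
  field_simp
  simp

theorem bubble_local_mass_matrix (n : ℕ) (hn : 1 ≤ n)
    (P : Fin (n + 1) → EuclideanSpace ℝ (Fin n)) (hP : AffineIndependent ℝ P)
    (hK : 0 < (volume (convexHull ℝ (Set.range P))).toReal)
    (φ : Fin (n + 1) → EuclideanSpace ℝ (Fin n) →ᵃ[ℝ] ℝ)
    (hφ : ∀ j k, φ j (P k) = if j = k then 1 else 0)
    (b : Fin (n + 1) → EuclideanSpace ℝ (Fin n) → ℝ)
    (hb : ∀ k x, b k x =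
      (∏ j ∈ Finset.univ.erase k, φ j x) /
        ((μH[(n : ℝ) - 1] (convexHull ℝ (P '' {j | j ≠ k}))).toReal⁻¹ *
          ∫ y in convexHull ℝ (P '' {j | j ≠ k}),
            (∏ j ∈ Finset.univ.erase k, φ j y) ∂(μH[(n : ℝ) - 1])))
    (j k : Fin (n + 1)) :
    ∫ x in convexHull ℝ (Set.range P), b j x * b k x =
      (2 : ℝ) ^ ((n : ℝ) - 3) * ((Nat.factorial (2 * n) : ℝ)) ^ 2 *
          (volume (convexHull ℝ (Set.range P))).toReal *
          (1 + if j = k then (1 : ℝ) else 0) /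
        ((Nat.factorial (3 * n) : ℝ) * (Nat.factorial n : ℝ)) := by
  obtain ⟨m, rfl⟩ : ∃ m, n = m + 1 := ⟨n - 1, by omega⟩
  have hden : ∀ k, ((μH[((m + 1 : ℕ) : ℝ) - 1] (convexHull ℝ (P '' {j | j ≠ k}))).toReal⁻¹ *
          ∫ y in convexHull ℝ (P '' {j | j ≠ k}),
            (∏ j ∈ Finset.univ.erase k, φ j y) ∂(μH[((m + 1 : ℕ) : ℝ) - 1])) =
      (m.factorial : ℝ) / (2 * m + 1).factorial := by
    intro k
    have hset : P '' {j | j ≠ k} = Set.range (P ∘ k.succAbove) := by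
      rw [Set.range_comp, Fin.range_succAbove]; rfl
    have hd : ((m + 1 : ℕ) : ℝ) - 1 = m := by push_cast; ring
    have hpr : ∀ y, ∏ j ∈ Finset.univ.erase k, φ j y = ∏ i, φ (k.succAbove i) y ^ 1 := by
      intro y
      rw [← Finset.compl_singleton, ← Fin.image_succAbove_univ,
        Finset.prod_image (fun a _ b _ h => Fin.succAbove_right_injective h)]
      simp
    obtain ⟨h0, h1⟩ := simplex_integral m (P ∘ k.succAbove) (fun i => φ (k.succAbove i))
      (fun i l => by simp [hφ]) (fun _ => 1)
    simp only [hd, hset, hpr]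
    rw [h1, ← mul_assoc, inv_mul_cancel₀ h0.ne', one_mul]
    have : m + (m + 1) = 2 * m + 1 := by ring
    simp [this]
  set D : ℝ := (m.factorial : ℝ) / (2 * m + 1).factorial with hD
  obtain ⟨c, hc⟩ : ∃ c : NNReal, (volume : Measure (EuclideanSpace ℝ (Fin (m + 1)))) =
      c • μH[((m + 1 : ℕ) : ℝ)] := by
    have : Measure.IsAddHaarMeasure (μH[((m + 1 : ℕ) : ℝ)] :
        Measure (EuclideanSpace ℝ (Fin (m + 1)))) := by
      simpa using isAddHaarMeasure_hausdorffMeasure (E := EuclideanSpace ℝ (Fin (m + 1)))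
    exact ⟨_, Measure.isAddLeftInvariant_eq_smul _ _⟩
  set α : Fin (m + 2) → ℕ := fun i => (if i = j then 0 else 1) + (if i = k then 0 else 1) with hα
  have hprod : ∀ x, b j x * b k x = (∏ i, φ i x ^ α i) * (1 / D ^ 2) := by
    intro x
    have e : ∀ l : Fin (m + 2), ∏ i ∈ Finset.univ.erase l, φ i x =
        ∏ i, φ i x ^ (if i = l then 0 else 1) := by
      intro l
      rw [← Finset.mul_prod_erase _ _ (Finset.mem_univ l)]
      simp only [if_true, pow_zero, one_mul]
      refine Finset.prod_congr rfl fun i hi => ?_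
      simp [Finset.ne_of_mem_erase hi]
    rw [hb, hb, hden, hden, e, e]
    simp only [hα, pow_add, Finset.prod_mul_distrib]
    ring
  have hs1 : ∀ l : Fin (m + 2), ∑ i : Fin (m + 2), (if i = l then 0 else 1) = m + 1 := by
    intro l
    rw [← Finset.add_sum_erase _ _ (Finset.mem_univ l), Finset.sum_congr rfl
      (g := fun _ => 1) (fun i hi => by simp [Finset.ne_of_mem_erase hi])]
    simp
  have hsum : ∑ i, α i = 2 * (m + 1) := by
    simp only [hα, Finset.sum_add_distrib, hs1]; ring
  have hfac : (∏ i, ((α i).factorial : ℝ)) * 2 = 2 ^ (m + 1) * (1 + if j = k then (1 : ℝ) else 0) := by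
    rw [← Finset.mul_prod_erase _ _ (Finset.mem_univ j)]
    by_cases hjk : j = k
    · subst hjk
      rw [Finset.prod_congr rfl (g := fun _ => (2 : ℝ))
        (fun i hi => by simp [hα, Finset.ne_of_mem_erase hi])]
      simp [hα]; ring
    · have hk : k ∈ Finset.univ.erase j := by simp [Ne.symm hjk]
      rw [← Finset.mul_prod_erase _ _ hk, Finset.prod_congr rfl (g := fun _ => (2 : ℝ))
        (fun i hi => by
          have h1 := Finset.ne_of_mem_erase hi
          have h2 := Finset.ne_of_mem_erase (Finset.mem_of_mem_erase hi)
          simp [hα, h1, h2])]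
      simp [hα, hjk, Ne.symm hjk]
      ring
  have hI := (simplex_integral (m + 1) P φ hφ α).2
  have hI2 : ∫ x in convexHull ℝ (Set.range P), ∏ i, φ i x ^ α i =
      (volume (convexHull ℝ (Set.range P))).toReal *
        (((m + 1).factorial : ℝ) * (∏ i, ((α i).factorial : ℝ)) /
          (m + 1 + ∑ i, α i).factorial) := by
    rw [hc, Measure.restrict_smul, integral_smul_nnreal_measure, hI]
    rw [Measure.smul_apply, ENNReal.smul_def, smul_eq_mul, ENNReal.toReal_mul, NNReal.smul_def,
      smul_eq_mul, ENNReal.coe_toReal, mul_assoc]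
  have hpow : (2 : ℝ) ^ (((m + 1 : ℕ) : ℝ) - 3) = 2 ^ (m + 1) / 8 := by
    rw [Real.rpow_sub two_pos, Real.rpow_natCast]; norm_num
  simp only [hprod]
  rw [integral_mul_const, hI2, hsum, hpow]
  have e3 : m + 1 + 2 * (m + 1) = 3 * (m + 1) := by ring
  have e2 : ((2 * (m + 1)).factorial : ℝ) = (2 * (m + 1)) * (2 * m + 1).factorial := by
    rw [show 2 * (m + 1) = (2 * m + 1) + 1 by ring, Nat.factorial_succ]; push_cast; ring
  have e1 : ((m + 1).factorial : ℝ) = (m + 1) * m.factorial := by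
    rw [Nat.factorial_succ]; push_cast; ring
  have hfac' : (∏ i, ((α i).factorial : ℝ)) =
      2 ^ (m + 1) * (1 + if j = k then (1 : ℝ) else 0) / 2 := by
    rw [← hfac]; ring
  rw [e3, e2, e1, hfac', hD]
  have p1 : ((3 * (m + 1)).factorial : ℝ) ≠ 0 := by positivity
  have p2 : (m.factorial : ℝ) ≠ 0 := by positivity
  have p3 : ((2 * m + 1).factorial : ℝ) ≠ 0 := by positivity
  have p4 : (m : ℝ) + 1 ≠ 0 := by positivity
  generalize (1 + if j = k then (1 : ℝ) else 0) = z
  field_simp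
  ring
end
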